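/- Let G be a simple connected positively curved (in the Lin–Lu–Yau sense) planar graph with minimum degree at least 3, drawn in the plane, let x be a vertex of maximum degree with deg(x) ≥ 18, and let Γ(x) = {v_0, v_1, …, v_{t−1}} be the neighbors of x in clockwise order (indices taken modulo t). If v_k v_{k+ℓ} forms an ℓ-cap for some ℓ ≥ 3, then there exists i ∈ {k, k+1, …, k+ℓ−2} such that v_i v_{i+2} forms a 2-cap and, in addition, the set of common neighbors of v_{i+1} and x is exactly {v_i, v_{i+2}}. -/

import Mathlib

open Filter Set

variable {V : Type*}

-- The `α`-lazy random walk distribution at vertex `x`.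
open Classical in
noncomputable def lazyWalk (G : SimpleGraph V) [G.LocallyFinite] (α : ℝ) (x : V) : V → ℝ :=
  fun v => if v = x then α else if G.Adj x v then (1 - α) / (G.degree x : ℝ) else 0

/-- `A` is a coupling between the finitely supported distributions `m₁` and `m₂`. -/
def IsCoupling (m₁ m₂ : V → ℝ) (A : V → V → ℝ) : Prop :=
  (Function.support fun p : V × V => A p.1 p.2).Finite ∧
  (∀ x y, 0 ≤ A x y ∧ A x y ≤ 1) ∧
  (∀ x, ∑ᶠ y, A x y = m₁ x) ∧
  (∀ y, ∑ᶠ x, A x y = m₂ y)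

/-- The transportation (Wasserstein) distance between two distributions on `V`,
with respect to the graph distance of `G`. -/
noncomputable def transportDist (G : SimpleGraph V) (m₁ m₂ : V → ℝ) : ℝ :=
  sInf {w : ℝ | ∃ A : V → V → ℝ, IsCoupling m₁ m₂ A ∧
    w = ∑ᶠ p : V × V, A p.1 p.2 * (G.dist p.1 p.2 : ℝ)}

/-- The `α`-Ricci curvature `κ_α(x,y)`. -/
noncomputable def alphaRicci (G : SimpleGraph V) [G.LocallyFinite] (α : ℝ) (x y : V) : ℝ :=
  1 - transportDist G (lazyWalk G α x) (lazyWalk G α y) / (G.dist x y : ℝ)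

/-- `κ` is the Lin–Lu–Yau Ricci curvature of the pair `(x,y)`:
the limit of `κ_α(x,y)/(1-α)` as `α → 1⁻`. -/
def HasLLYCurv (G : SimpleGraph V) [G.LocallyFinite] (x y : V) (κ : ℝ) : Prop :=
  Tendsto (fun α : ℝ => alphaRicci G α x y / (1 - α)) (nhdsWithin 1 (Set.Iio 1)) (nhds κ)

/-- `G` is positively curved: every edge has positive Lin–Lu–Yau Ricci curvature. -/
def PositivelyCurved (G : SimpleGraph V) [G.LocallyFinite] : Prop :=
  ∀ ⦃x y : V⦄, G.Adj x y → ∃ κ : ℝ, 0 < κ ∧ HasLLYCurv G x y κ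

/-- `G` is planar: it admits a topological embedding in the plane, i.e. an injective
placement of the vertices together with arcs for the edges, where arcs are injective
continuous curves joining the endpoints, not passing through any other vertex, and
two arcs of distinct edges meet only in common endpoints. -/
def IsPlanar (G : SimpleGraph V) : Prop :=
  ∃ (f : V → ℝ × ℝ) (e : ∀ u v : V, G.Adj u v → Set.Icc (0:ℝ) 1 → ℝ × ℝ),
    Function.Injective f ∧
    (∀ u v (h : G.Adj u v), Continuous (e u v h)) ∧
    (∀ u v (h : G.Adj u v), Function.Injective (e u v h)) ∧
    (∀ u v (h : G.Adj u v),
      e u v h ⟨0, Set.left_mem_Icc.mpr zero_le_one⟩ = f u ∧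
      e u v h ⟨1, Set.right_mem_Icc.mpr zero_le_one⟩ = f v) ∧
    (∀ u v (h : G.Adj u v) (w : V), w ≠ u → w ≠ v → f w ∉ Set.range (e u v h)) ∧
    (∀ u v (h : G.Adj u v) (u' v' : V) (h' : G.Adj u' v'), ({u, v} : Set V) ≠ {u', v'} →
      Set.range (e u v h) ∩ Set.range (e u' v' h') ⊆ (f '' {u, v}) ∩ (f '' {u', v'}))

/-- Given a vertex `x` whose neighbors are enumerated in clockwise order by `v`
(indices modulo the degree of `x`, encoded by the periodicity of `v`),
`v k` and `v (k+ℓ)` form an `ℓ`-cap: either `v k v (k+ℓ)` is an edge (`ℓ`-arc), or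
there is a vertex `z ≠ x` adjacent to both `v k` and `v (k+ℓ)` but to no `v (k+i)`
with `1 ≤ i ≤ ℓ-1`. -/
def IsCap (G : SimpleGraph V) (x : V) (v : ℕ → V) (k ℓ : ℕ) : Prop :=
  G.Adj (v k) (v (k + ℓ)) ∨
  ∃ z : V, z ≠ x ∧ G.Adj (v k) z ∧ G.Adj (v (k + ℓ)) z ∧
    ∀ i : ℕ, 1 ≤ i → i ≤ ℓ - 1 → ¬ G.Adj (v (k + i)) z

theorem exists_log_square (F : ℝ × ℝ → ℂ) (hF : Continuous F) (h0 : ∀ p, F p ≠ 0) :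
    ∃ L : ℝ × ℝ → ℂ, Continuous L ∧ ∀ p, Complex.exp (L p) = F p := by
  obtain ⟨f, ⟨-, hf⟩, -⟩ := Complex.isCoveringMapOn_exp.existsUnique_continuousMap_lifts
    (⟨F, hF⟩ : C(ℝ × ℝ, ℂ)) (a₀ := (0, 0)) (e₀ := Complex.log (F (0, 0)))
    (Complex.exp_log (h0 _)) (fun p => h0 p)
  exact ⟨f, f.continuous, fun p => congrFun hf p⟩

/-- Two continuous functions whose exponentials differ by a constant factor differ by a constant. -/
theorem log_diff_const (g h : ℝ → ℂ) (hg : Continuous g) (hh : Continuous h) (c : ℂ)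
    (hc : ∀ u, Complex.exp (g u) = c * Complex.exp (h u)) (s t : ℝ) :
    g s - g t = h s - h t := by
  have hcont : Continuous (fun u => g u - h u) := hg.sub hh
  have hexp : ∀ u, Complex.exp (g u - h u) = c := by
    intro u
    rw [Complex.exp_sub, hc, mul_div_assoc, div_self (Complex.exp_ne_zero _), mul_one]
  have := Complex.isCoveringMap_exp.const_of_comp hcont (by
    intro a a'; apply Subtype.ext; simp [hexp]) s t
  linear_combination this

theorem one_sub_mem_slitPlane (a b : ℂ) (ha : ‖a‖ = 1) (hb : ‖b‖ ≤ 1) (hab : b ≠ a) :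
    1 - (starRingEnd ℂ) a * b ∈ Complex.slitPlane := by
  rw [Complex.mem_slitPlane_iff]
  by_contra hcon
  push Not at hcon
  obtain ⟨h1, h2⟩ := hcon
  have hn : ‖(starRingEnd ℂ) a * b‖ ≤ 1 := by
    rw [norm_mul, RCLike.norm_conj, ha, one_mul]; exact hb
  have hre := (Complex.re_le_norm ((starRingEnd ℂ) a * b)).trans hn
  have h3 : (starRingEnd ℂ) a * b = 1 := by
    apply Complex.ext
    · simp only [Complex.sub_re, Complex.one_re] at h1 ⊢
      linarith
    · simp only [Complex.sub_im, Complex.one_im] at h2 ⊢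
      linarith
  apply hab
  have h4 : a * (starRingEnd ℂ) a = 1 := by
    rw [Complex.mul_conj, Complex.normSq_eq_norm_sq, ha]; simp
  calc b = (a * (starRingEnd ℂ) a) * b := by rw [h4, one_mul]
    _ = a * ((starRingEnd ℂ) a * b) := by ring
    _ = a := by rw [h3, mul_one]

theorem side_change (a : ℂ) (b : ℝ → ℂ) (L : ℝ → ℂ) (hb : Continuous b) (hL : Continuous L)
    (ha : ‖a‖ = 1) (hb1 : ∀ u, ‖b u‖ ≤ 1) (hab : ∀ u, b u ≠ a)
    (c : ℂ) (hexp : ∀ u, Complex.exp (L u) = c * (a - b u)) (s t : ℝ) :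
    (L s - L t).im = (1 - (starRingEnd ℂ) a * b s).arg - (1 - (starRingEnd ℂ) a * b t).arg := by
  have hs := fun u => one_sub_mem_slitPlane a (b u) ha (hb1 u) (hab u)
  have h4 : a * (starRingEnd ℂ) a = 1 := by
    rw [Complex.mul_conj, Complex.normSq_eq_norm_sq, ha]; simp
  have := log_diff_const L (fun u => Complex.log (1 - (starRingEnd ℂ) a * b u)) hL
    (Continuous.clog (by fun_prop) hs) (c * a) (by
      intro u
      rw [hexp, Complex.exp_log (Complex.slitPlane_ne_zero (hs u))]
      linear_combination (c * b u) * h4) s t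
  rw [this]
  simp [Complex.log_im]

theorem disc_args (a b : ℝ → ℂ) (ha : Continuous a) (hb : Continuous b)
    (ha1 : ∀ u, ‖a u‖ ≤ 1) (hb1 : ∀ u, ‖b u‖ ≤ 1) (hab : ∀ s u, a s ≠ b u)
    (na0 : ‖a 0‖ = 1) (na1 : ‖a 1‖ = 1) (nb0 : ‖b 0‖ = 1) (nb1 : ‖b 1‖ = 1) :
    (1 - (starRingEnd ℂ) (a 0) * b 1).arg - (1 - (starRingEnd ℂ) (a 0) * b 0).arg
    = (1 - (starRingEnd ℂ) (a 1) * b 1).arg - (1 - (starRingEnd ℂ) (a 1) * b 0).arg := by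
  obtain ⟨L, hL, hexp⟩ := exists_log_square (fun p => a p.1 - b p.2) (by fun_prop)
    (fun p => sub_ne_zero.2 (hab _ _))
  have e1 := side_change (a 0) b (fun u => L (0, u)) hb (by fun_prop) na0 hb1
    (fun u => (hab _ _).symm) 1 (fun u => by rw [hexp]; simp) 1 0
  have e2 := side_change (a 1) b (fun u => L (1, u)) hb (by fun_prop) na1 hb1
    (fun u => (hab _ _).symm) 1 (fun u => by rw [hexp]; simp) 1 0
  have e3 := side_change (b 0) a (fun u => L (u, 0)) ha (by fun_prop) nb0 ha1
    (fun u => (hab _ _)) (-1) (fun u => by rw [hexp]; simp) 1 0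
  have e4 := side_change (b 1) a (fun u => L (u, 1)) ha (by fun_prop) nb1 ha1
    (fun u => (hab _ _)) (-1) (fun u => by rw [hexp]; simp) 1 0
  have key : ∀ s u, ‖a s‖ = 1 → (1 - (starRingEnd ℂ) (b u) * a s).arg =
      - (1 - (starRingEnd ℂ) (a s) * b u).arg := by
    intro s u hn
    have h := one_sub_mem_slitPlane (a s) (b u) hn (hb1 u) (hab _ _).symm
    have h2 : 1 - (starRingEnd ℂ) (b u) * a s = (starRingEnd ℂ) (1 - (starRingEnd ℂ) (a s) * b u) := by
      simp [mul_comm]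
    rw [h2, Complex.arg_conj, if_neg]
    exact (Complex.mem_slitPlane_iff_arg.1 h).1
  rw [key 1 0 na1, key 0 0 na0] at e3
  rw [key 1 1 na1, key 0 1 na0] at e4
  simp only [Complex.sub_im] at e1 e2 e3 e4
  linarith

theorem arg_one_sub (α β : ℝ) (h1 : α < β) (h2 : β - α < 2 * Real.pi) :
    (1 - (starRingEnd ℂ) (Complex.exp (α * Complex.I)) * Complex.exp (β * Complex.I)).arg
      = (β - α) / 2 - Real.pi / 2 := by
  have h3 : 1 - (starRingEnd ℂ) (Complex.exp (α * Complex.I)) * Complex.exp (β * Complex.I) =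
      ((2 * Real.sin ((β - α) / 2) : ℝ) : ℂ) *
        (Complex.cos (((β - α) / 2 - Real.pi / 2 : ℝ) : ℂ) +
         Complex.sin (((β - α) / 2 - Real.pi / 2 : ℝ) : ℂ) * Complex.I) := by
    rw [← Complex.exp_conj, ← Complex.exp_add]
    have : (starRingEnd ℂ) (α * Complex.I) + β * Complex.I =
      (((β - α) / 2 : ℝ) : ℂ) * Complex.I + (((β - α) / 2 : ℝ) : ℂ) * Complex.I := by
      simp; ring
    rw [this, Complex.exp_add, Complex.exp_mul_I]
    push_cast
    rw [Complex.cos_sub_pi_div_two, Complex.sin_sub_pi_div_two]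
    have hh := Complex.sin_sq_add_cos_sq (((β - α) / 2 : ℂ))
    linear_combination (-1 : ℂ) * hh - Complex.sin ((β - α) / 2 : ℂ) ^ 2 * Complex.I_sq
  have hpi := Real.pi_pos
  rw [h3, Complex.arg_mul_cos_add_sin_mul_I]
  · apply mul_pos two_pos
    apply Real.sin_pos_of_pos_of_lt_pi <;> linarith
  · constructor <;> linarith

theorem arg_one_sub' (α β : ℝ) (h1 : β < α) (h2 : α - β < 2 * Real.pi) :
    (1 - (starRingEnd ℂ) (Complex.exp (α * Complex.I)) * Complex.exp (β * Complex.I)).arg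
      = (β - α) / 2 + Real.pi / 2 := by
  have h := arg_one_sub α (β + 2 * Real.pi) (by linarith) (by linarith)
  have : Complex.exp (((β + 2 * Real.pi : ℝ) : ℂ) * Complex.I) = Complex.exp (β * Complex.I) := by
    push_cast
    rw [add_mul, Complex.exp_add, Complex.exp_two_pi_mul_I, mul_one]
  rw [this] at h
  rw [h]; ring

/-- Interlacing chords of the closed unit disc meet. -/
theorem disc_noncross (a b : ℝ → ℂ) (ha : Continuous a) (hb : Continuous b)
    (ha1 : ∀ u, ‖a u‖ ≤ 1) (hb1 : ∀ u, ‖b u‖ ≤ 1) (hab : ∀ s u, a s ≠ b u)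
    (na0 : ‖a 0‖ = 1) (na1 : ‖a 1‖ = 1) (nb0 : ‖b 0‖ = 1) (nb1 : ‖b 1‖ = 1)
    (h1 : (a 0).arg < (b 0).arg) (h2 : (b 0).arg < (a 1).arg)
    (h3 : (b 1).arg < (a 0).arg ∨ (a 1).arg < (b 1).arg) : False := by
  have h := disc_args a b ha hb ha1 hb1 hab na0 na1 nb0 nb1
  have e : ∀ z : ℂ, ‖z‖ = 1 → z = Complex.exp (z.arg * Complex.I) := by
    intro z hz
    conv_lhs => rw [← Complex.norm_mul_exp_arg_mul_I z, hz]
    simp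
  have lt : ∀ z w : ℂ, z.arg - w.arg < 2 * Real.pi := by
    intro z w
    have := Complex.arg_le_pi z
    have := Complex.neg_pi_lt_arg w
    linarith
  have hpi := Real.pi_pos
  have c1 := arg_one_sub _ _ h1 (lt _ _)
  have c2 := arg_one_sub' _ _ h2 (lt _ _)
  rw [← e _ na0, ← e _ nb0] at c1
  rw [← e _ na1, ← e _ nb0] at c2
  rcases h3 with h3 | h3
  · have c3 := arg_one_sub' _ _ h3 (lt _ _)
    have c4 := arg_one_sub' _ _ (h3.trans (h1.trans h2)) (lt _ _)
    rw [← e _ na0, ← e _ nb1] at c3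
    rw [← e _ na1, ← e _ nb1] at c4
    linarith
  · have c3 := arg_one_sub _ _ (h1.trans (h2.trans h3)) (lt _ _)
    have c4 := arg_one_sub _ _ h3 (lt _ _)
    rw [← e _ na0, ← e _ nb1] at c3
    rw [← e _ na1, ← e _ nb1] at c4
    linarith

/-- Interlacing paths outside of an open disc meet. -/
theorem ext_noncross (c : ℂ) (r : ℝ) (hr : 0 < r) (KA KB : Set ℂ)
    (hA : ∀ p ∈ KA, r ≤ ‖p - c‖) (hB : ∀ p ∈ KB, r ≤ ‖p - c‖) (hdisj : Disjoint KA KB)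
    (a0 a1 b0 b1 : ℂ) (jA : JoinedIn KA a0 a1) (jB : JoinedIn KB b0 b1)
    (na0 : ‖a0 - c‖ = r) (na1 : ‖a1 - c‖ = r) (nb0 : ‖b0 - c‖ = r) (nb1 : ‖b1 - c‖ = r)
    (h1 : (a0 - c).arg < (b0 - c).arg) (h2 : (b0 - c).arg < (a1 - c).arg)
    (h3 : (b1 - c).arg < (a0 - c).arg ∨ (a1 - c).arg < (b1 - c).arg) : False := by
  set g : ℂ → ℂ := fun p => ((r / ‖p - c‖ ^ 2 : ℝ) : ℂ) * (p - c) with hg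
  have gnorm : ∀ p, r ≤ ‖p - c‖ → ‖g p‖ = r / ‖p - c‖ := by
    intro p hp
    have hpos : 0 < ‖p - c‖ := lt_of_lt_of_le hr hp
    simp only [hg, norm_mul, Complex.norm_real, Real.norm_eq_abs]
    rw [abs_of_pos (by positivity)]
    field_simp
  have garg : ∀ p, r ≤ ‖p - c‖ → (g p).arg = (p - c).arg := by
    intro p hp
    have hpos : 0 < ‖p - c‖ := lt_of_lt_of_le hr hp
    simp only [hg]
    exact Complex.arg_real_mul _ (by positivity)
  have ginj : ∀ p q, r ≤ ‖p - c‖ → r ≤ ‖q - c‖ → g p = g q → p = q := by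
    intro p q hp hq hpq
    have hpp : 0 < ‖p - c‖ := lt_of_lt_of_le hr hp
    have hqp : 0 < ‖q - c‖ := lt_of_lt_of_le hr hq
    have hn : ‖p - c‖ = ‖q - c‖ := by
      have := congrArg norm hpq
      rw [gnorm p hp, gnorm q hq] at this
      field_simp at this
      exact this.symm
    simp only [hg, hn] at hpq
    have hne : ((r / ‖q - c‖ ^ 2 : ℝ) : ℂ) ≠ 0 := by
      exact_mod_cast (by positivity : (r / ‖q - c‖ ^ 2 : ℝ) ≠ 0)
    have := mul_left_cancel₀ hne hpq
    exact sub_left_inj.1 this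
  obtain ⟨γ, hγ⟩ := jA
  obtain ⟨δ, hδ⟩ := jB
  have mγ : ∀ u, γ.extend u ∈ KA := by
    intro u
    have : γ.extend u ∈ Set.range γ := by rw [← Path.extend_range]; exact ⟨u, rfl⟩
    obtain ⟨s, hs⟩ := this
    rw [← hs]; exact hγ s
  have mδ : ∀ u, δ.extend u ∈ KB := by
    intro u
    have : δ.extend u ∈ Set.range δ := by rw [← Path.extend_range]; exact ⟨u, rfl⟩
    obtain ⟨s, hs⟩ := this
    rw [← hs]; exact hδ s
  have gcont : ∀ ε : ℝ → ℂ, Continuous ε → (∀ u, r ≤ ‖ε u - c‖) → Continuous (fun u => g (ε u)) := by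
    intro ε hε h
    simp only [hg]
    apply Continuous.mul _ (by fun_prop)
    apply Complex.continuous_ofReal.comp
    apply Continuous.div (by fun_prop) (by fun_prop)
    intro u
    have : 0 < ‖ε u - c‖ := lt_of_lt_of_le hr (h u)
    positivity
  have gle : ∀ p, r ≤ ‖p - c‖ → ‖g p‖ ≤ 1 := by
    intro p hp
    rw [gnorm p hp]
    exact div_le_one_of_le₀ hp (norm_nonneg _)
  have geq : ∀ p, ‖p - c‖ = r → ‖g p‖ = 1 := by
    intro p hp
    rw [gnorm p hp.ge, hp, div_self hr.ne']
  refine disc_noncross (fun u => g (γ.extend u)) (fun u => g (δ.extend u))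
    (gcont _ γ.continuous_extend (fun u => hA _ (mγ u)))
    (gcont _ δ.continuous_extend (fun u => hB _ (mδ u)))
    (fun u => gle _ (hA _ (mγ u))) (fun u => gle _ (hB _ (mδ u))) ?_ ?_ ?_ ?_ ?_ ?_ ?_ ?_
  · intro s u h
    have h' := ginj _ _ (hA _ (mγ s)) (hB _ (mδ u)) h
    exact Set.disjoint_left.1 hdisj (mγ s) (h' ▸ mδ u)
  all_goals simp only [Path.extend_zero, Path.extend_one]
  · exact geq _ na0
  · exact geq _ na1
  · exact geq _ nb0
  · exact geq _ nb1
  · rw [garg _ na0.ge, garg _ nb0.ge]; exact h1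
  · rw [garg _ na1.ge, garg _ nb0.ge]; exact h2
  · rw [garg _ na0.ge, garg _ nb1.ge, garg _ na1.ge]; exact h3

/-- The final part of an arc that leaves a disc. -/
theorem exists_tail (γ : Set.Icc (0:ℝ) 1 → ℂ) (hγ : Continuous γ) (c : ℂ) (r : ℝ)
    (h0 : ‖γ ⟨0, Set.left_mem_Icc.mpr zero_le_one⟩ - c‖ ≤ r)
    (h1 : r < ‖γ ⟨1, Set.right_mem_Icc.mpr zero_le_one⟩ - c‖) :
    ∃ (q : ℂ) (K : Set ℂ), K ⊆ Set.range γ ∧ ‖q - c‖ = r ∧ q ∈ K ∧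
      JoinedIn K q (γ ⟨1, Set.right_mem_Icc.mpr zero_le_one⟩) ∧ ∀ p ∈ K, r ≤ ‖p - c‖ := by
  set G : ℝ → ℂ := fun s => γ (Set.projIcc 0 1 zero_le_one s) with hG
  have hGc : Continuous G := hγ.comp continuous_projIcc
  have hG0 : G 0 = γ ⟨0, Set.left_mem_Icc.mpr zero_le_one⟩ := by simp only [hG, Set.projIcc_left]
  have hG1 : G 1 = γ ⟨1, Set.right_mem_Icc.mpr zero_le_one⟩ := by simp only [hG, Set.projIcc_right]
  have hcomp : IsCompact (Set.Icc (0:ℝ) 1 ∩ {s | ‖G s - c‖ ≤ r}) :=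
    isCompact_Icc.inter_right (isClosed_le (by fun_prop) continuous_const)
  obtain ⟨τ, ⟨hτ, hτr⟩, hmax⟩ := hcomp.exists_isGreatest
    ⟨0, Set.left_mem_Icc.mpr zero_le_one, by simpa [hG0] using h0⟩
  have hlt : τ < 1 := by
    rcases lt_or_eq_of_le hτ.2 with h | h
    · exact h
    · rw [h] at hτr
      simp only [Set.mem_ofPred_eq, hG1] at hτr
      linarith
  have hout : ∀ s, τ < s → s ≤ 1 → r < ‖G s - c‖ := by
    intro s hs hs1
    by_contra hcon
    push Not at hcon
    have := hmax ⟨⟨hτ.1.trans hs.le, hs1⟩, hcon⟩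
    linarith
  have hge : r ≤ ‖G τ - c‖ := by
    have hcl : τ ∈ closure (Set.Ioc τ 1) := by
      rw [closure_Ioc hlt.ne]; exact ⟨le_rfl, hlt.le⟩
    have : closure (Set.Ioc τ 1) ⊆ {s | r ≤ ‖G s - c‖} :=
      closure_minimal (fun s hs => (hout s hs.1 hs.2).le) (isClosed_le continuous_const (by fun_prop))
    exact this hcl
  refine ⟨G τ, G '' Set.Icc τ 1, ?_, le_antisymm hτr hge, ⟨τ, ⟨le_rfl, hlt.le⟩, rfl⟩, ?_, ?_⟩
  · rintro _ ⟨s, -, rfl⟩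
    exact ⟨_, rfl⟩
  · rw [← hG1]
    have hp : IsPathConnected (G '' Set.Icc τ 1) :=
      ((convex_Icc τ 1).isPathConnected ⟨τ, le_rfl, hlt.le⟩).image hGc
    exact hp.joinedIn _ ⟨τ, ⟨le_rfl, hlt.le⟩, rfl⟩ _ ⟨1, ⟨hlt.le, le_rfl⟩, rfl⟩
  · rintro _ ⟨s, hs, rfl⟩
    rcases lt_or_eq_of_le hs.1 with h | h
    · exact (hout s h hs.2).le
    · rw [← h]; exact hge

/-- `A` is the vertex set of a path of length one or two from `a` to `b` avoiding `x`. -/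
def PLink {V : Type*} (G : SimpleGraph V) (x a b : V) (A : Set V) : Prop :=
  (G.Adj a b ∧ A = {a, b}) ∨ ∃ z, z ≠ x ∧ G.Adj a z ∧ G.Adj b z ∧ A = {a, z, b}

theorem PLink.symm {V : Type*} {G : SimpleGraph V} {x a b : V} {A : Set V}
    (h : PLink G x a b A) : PLink G x b a A := by
  rcases h with ⟨h, rfl⟩ | ⟨z, hz, h1, h2, rfl⟩
  · exact Or.inl ⟨h.symm, Set.pair_comm _ _⟩
  · refine Or.inr ⟨z, hz, h2, h1, ?_⟩
    ext; simp; tauto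

theorem exists_angle {V : Type*} (G : SimpleGraph V) [G.LocallyFinite] (hplanar : IsPlanar G)
    (x : V) : ∃ θ : V → ℝ,
      (∀ a b, G.Adj x a → G.Adj x b → θ a = θ b → a = b) ∧
      ∀ a0 a1 b0 b1 A B, G.Adj x a0 → G.Adj x a1 → G.Adj x b0 → G.Adj x b1 →
        PLink G x a0 a1 A → PLink G x b0 b1 B → Disjoint A B →
        θ a0 < θ b0 → θ b0 < θ a1 → (θ b1 < θ a0 ∨ θ a1 < θ b1) → False := by
  classical
  obtain ⟨f0, e0, hf0, hec0, -, hend0, hmiss0, hcross0⟩ := hplanar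
  set φ := Complex.equivRealProdCLM.symm with hφ
  have hφi : Function.Injective φ := φ.injective
  set f : V → ℂ := fun v => φ (f0 v) with hf
  set e : ∀ u v : V, G.Adj u v → Set.Icc (0:ℝ) 1 → ℂ := fun u v h s => φ (e0 u v h s) with he
  have hfi : Function.Injective f := hφi.comp hf0
  have hec : ∀ u v h, Continuous (e u v h) := fun u v h => φ.continuous.comp (hec0 u v h)
  have hes : ∀ u v h, e u v h ⟨0, Set.left_mem_Icc.mpr zero_le_one⟩ = f u :=
    fun u v h => congrArg φ (hend0 u v h).1
  have het : ∀ u v h, e u v h ⟨1, Set.right_mem_Icc.mpr zero_le_one⟩ = f v :=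
    fun u v h => congrArg φ (hend0 u v h).2
  have hmiss : ∀ u v (h : G.Adj u v) (w : V), w ≠ u → w ≠ v → f w ∉ Set.range (e u v h) := by
    rintro u v h w h1 h2 ⟨s, hs⟩
    exact hmiss0 u v h w h1 h2 ⟨s, hφi hs⟩
  have hcross : ∀ u v (h : G.Adj u v) (u' v' : V) (h' : G.Adj u' v'),
      ({u, v} : Set V) ≠ {u', v'} → ∀ p, p ∈ Set.range (e u v h) → p ∈ Set.range (e u' v' h') →
      ∃ w, w ∈ ({u, v} : Set V) ∧ w ∈ ({u', v'} : Set V) ∧ p = f w := by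
    rintro u v h u' v' h' hne p ⟨s, hs⟩ ⟨s', hs'⟩
    have hss : e0 u v h s = e0 u' v' h' s' := hφi (hs.trans hs'.symm)
    obtain ⟨⟨w, hw, hw2⟩, ⟨w', hw', hw2'⟩⟩ :=
      hcross0 u v h u' v' h' hne ⟨⟨s, rfl⟩, ⟨s', hss.symm⟩⟩
    have : w = w' := hf0 (hw2.trans hw2'.symm)
    subst this
    exact ⟨w, hw, hw', by rw [← hs]; exact congrArg φ hw2.symm⟩
  clear_value f e
  -- a small disc
  set C : Set ℂ := (⋃ a ∈ G.neighborFinset x, {f a}) ∪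
    ⋃ a ∈ G.neighborFinset x, ⋃ z ∈ (G.neighborFinset a).attach,
      (if z.1 = x then ∅ else
        Set.range (e a z.1 ((G.mem_neighborFinset _ _).1 z.2))) with hC
  have hCc : IsClosed C := by
    apply IsClosed.union
    · exact isClosed_biUnion_finset (fun a _ => isClosed_singleton)
    · apply isClosed_biUnion_finset
      intro a _
      apply isClosed_biUnion_finset
      intro z _
      split_ifs
      · exact isClosed_empty
      · exact (isCompact_range (hec _ _ _)).isClosed
  have hxC : f x ∉ C := by
    rintro (h | h)
    · simp only [Set.mem_iUnion, Set.mem_singleton_iff] at h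
      obtain ⟨a, ha, hh⟩ := h
      have := hfi hh
      subst this
      simp at ha
    · simp only [Set.mem_iUnion] at h
      obtain ⟨a, ha, z, _, hz⟩ := h
      split_ifs at hz with hzx
      · exact hz
      · refine hmiss _ _ _ x ?_ (Ne.symm hzx) hz
        rintro rfl
        simp at ha
  obtain ⟨r0, hr0, hball⟩ := Metric.isOpen_iff.1 hCc.isOpen_compl (f x) hxC
  set r := r0 / 2 with hr
  have hrpos : 0 < r := by positivity
  have hCr : ∀ p ∈ C, r < ‖p - f x‖ := by
    intro p hp
    by_contra hcon
    push Not at hcon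
    have hpb : p ∈ Metric.ball (f x) r0 := by
      rw [Metric.mem_ball, dist_eq_norm]
      linarith
    exact hball hpb hp
  have hfa : ∀ a, G.Adj x a → r < ‖f a - f x‖ := by
    intro a ha
    apply hCr
    left
    simp only [Set.mem_iUnion]
    exact ⟨a, (G.mem_neighborFinset _ _).2 ha, rfl⟩
  have hea : ∀ a z (h : G.Adj a z), G.Adj x a → z ≠ x → ∀ p ∈ Set.range (e a z h),
      r < ‖p - f x‖ := by
    intro a z h ha hz p hp
    apply hCr
    right
    simp only [Set.mem_iUnion]
    refine ⟨a, (G.mem_neighborFinset _ _).2 ha, ⟨z, (G.mem_neighborFinset _ _).2 h⟩,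
      Finset.mem_attach _ _, ?_⟩
    rw [if_neg hz]; exact hp
  -- tails
  have htail : ∀ a, ∃ (q : ℂ) (K : Set ℂ), ∀ h : G.Adj x a,
      K ⊆ Set.range (e x a h) ∧ ‖q - f x‖ = r ∧ q ∈ K ∧
      JoinedIn K q (f a) ∧ ∀ p ∈ K, r ≤ ‖p - f x‖ := by
    intro a
    by_cases h : G.Adj x a
    · obtain ⟨q, K, h1, h2, h3, h4, h5⟩ := exists_tail (e x a h) (hec x a h) (f x) r
        (by rw [hes]; simpa using hrpos.le) (by rw [het]; exact hfa a h)
      refine ⟨q, K, fun _ => ⟨h1, h2, h3, ?_, h5⟩⟩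
      rw [het] at h4; exact h4
    · exact ⟨0, ∅, fun h' => absurd h' h⟩
  choose q T hT using htail
  have hj : ∀ u v (h : G.Adj u v), JoinedIn (Set.range (e u v h)) (f u) (f v) := by
    intro u v h
    haveI : PathConnectedSpace (Set.Icc (0:ℝ) 1) := isPathConnected_iff_pathConnectedSpace.1
      ((convex_Icc 0 1).isPathConnected ⟨0, Set.left_mem_Icc.mpr zero_le_one⟩)
    have hp : IsPathConnected (Set.range (e u v h)) := isPathConnected_range (hec u v h)
    exact hp.joinedIn _ ⟨_, hes u v h⟩ _ ⟨_, het u v h⟩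
  -- the curve belonging to a link
  have hcurve : ∀ a b A, G.Adj x a → G.Adj x b → PLink G x a b A → ∃ K : Set ℂ,
      JoinedIn K (q a) (q b) ∧ (∀ p ∈ K, r ≤ ‖p - f x‖) ∧
      ∀ p ∈ K, ∃ u v, ∃ h : G.Adj u v, u ∈ insert x A ∧ v ∈ insert x A ∧
        p ∈ Set.range (e u v h) := by
    intro a b A ha hb hL
    obtain ⟨a1, a2, a3, a4, a5⟩ := hT a ha
    obtain ⟨b1, b2, b3, b4, b5⟩ := hT b hb
    rcases hL with ⟨hab, rfl⟩ | ⟨z, hzx, haz, hbz, rfl⟩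
    · refine ⟨T a ∪ Set.range (e a b hab) ∪ T b, ?_, ?_, ?_⟩
      · refine ((a4.mono ?_).trans ((hj a b hab).mono ?_)).trans (b4.symm.mono ?_)
        · exact fun p hp => Or.inl (Or.inl hp)
        · exact fun p hp => Or.inl (Or.inr hp)
        · exact fun p hp => Or.inr hp
      · rintro p ((hp | hp) | hp)
        · exact a5 p hp
        · exact (hea a b hab ha hb.ne' p hp).le
        · exact b5 p hp
      · rintro p ((hp | hp) | hp)
        · exact ⟨x, a, ha, by simp, by simp, a1 hp⟩
        · exact ⟨a, b, hab, by simp, by simp, hp⟩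
        · exact ⟨x, b, hb, by simp, by simp, b1 hp⟩
    · refine ⟨T a ∪ Set.range (e a z haz) ∪ (Set.range (e b z hbz) ∪ T b), ?_, ?_, ?_⟩
      · refine ((a4.mono ?_).trans ((hj a z haz).mono ?_)).trans
          (((hj b z hbz).symm.mono ?_).trans (b4.symm.mono ?_))
        · exact fun p hp => Or.inl (Or.inl hp)
        · exact fun p hp => Or.inl (Or.inr hp)
        · exact fun p hp => Or.inr (Or.inl hp)
        · exact fun p hp => Or.inr (Or.inr hp)
      · rintro p ((hp | hp) | (hp | hp))
        · exact a5 p hp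
        · exact (hea a z haz ha hzx p hp).le
        · exact (hea b z hbz hb hzx p hp).le
        · exact b5 p hp
      · rintro p ((hp | hp) | (hp | hp))
        · exact ⟨x, a, ha, by simp, by simp, a1 hp⟩
        · exact ⟨a, z, haz, by simp, by simp, hp⟩
        · exact ⟨b, z, hbz, by simp, by simp, hp⟩
        · exact ⟨x, b, hb, by simp, by simp, b1 hp⟩
  have hmeet : ∀ (A B : Set V), x ∉ A → x ∉ B → Disjoint A B → ∀ p, r ≤ ‖p - f x‖ →
      (∃ u v, ∃ h : G.Adj u v, u ∈ insert x A ∧ v ∈ insert x A ∧ p ∈ Set.range (e u v h)) →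
      (∃ u v, ∃ h : G.Adj u v, u ∈ insert x B ∧ v ∈ insert x B ∧ p ∈ Set.range (e u v h)) →
      False := by
    rintro A B hxA hxB hAB p hp ⟨u, v, h, hu, hv, hpe⟩ ⟨u', v', h', hu', hv', hpe'⟩
    have hcap : ∀ w, w ∈ insert x A → w ∈ insert x B → w = x := by
      rintro w (rfl | h1) (h2 | h2)
      · rfl
      · rfl
      · exact h2
      · exact absurd h2 (Set.disjoint_left.1 hAB h1)
    have hne : ({u, v} : Set V) ≠ {u', v'} := by
      intro heq
      have huB : u ∈ insert x B := by
        have : u ∈ ({u', v'} : Set V) := heq ▸ (by simp)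
        rcases this with rfl | rfl
        · exact hu'
        · exact hv'
      have hvB : v ∈ insert x B := by
        have : v ∈ ({u', v'} : Set V) := heq ▸ (by simp)
        rcases this with rfl | rfl
        · exact hu'
        · exact hv'
      exact h.ne ((hcap u hu huB).trans (hcap v hv hvB).symm)
    obtain ⟨w, hw, hw', hpw⟩ := hcross u v h u' v' h' hne p hpe hpe'
    have hwx : w = x := by
      apply hcap
      · rcases hw with rfl | rfl
        · exact hu
        · exact hv
      · rcases hw' with rfl | rfl
        · exact hu'
        · exact hv'
    rw [hpw, hwx] at hp
    simp at hp
    linarith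
  refine ⟨fun a => (q a - f x).arg, ?_, ?_⟩
  · intro a b ha hb hab
    by_contra hne
    obtain ⟨a1, a2, a3, a4, a5⟩ := hT a ha
    obtain ⟨b1, b2, b3, b4, b5⟩ := hT b hb
    have hq : q a = q b := by
      have h1 := Complex.norm_mul_exp_arg_mul_I (q a - f x)
      have h2 := Complex.norm_mul_exp_arg_mul_I (q b - f x)
      simp only at hab
      rw [a2, hab] at h1
      rw [b2] at h2
      exact sub_left_inj.1 (h1.symm.trans h2)
    refine hmeet {a} {b} (by simpa using ha.ne) (by simpa using hb.ne) (by simpa using hne)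
      (q a) a2.ge ⟨x, a, ha, by simp, by simp, a1 a3⟩ ⟨x, b, hb, by simp, by simp, hq ▸ b1 b3⟩
  · intro a0 a1 b0 b1 A B ha0 ha1 hb0 hb1 hA hB hdisj h1 h2 h3
    obtain ⟨KA, jA, rA, cA⟩ := hcurve a0 a1 A ha0 ha1 hA
    obtain ⟨KB, jB, rB, cB⟩ := hcurve b0 b1 B hb0 hb1 hB
    have hxL : ∀ a b A, G.Adj x a → G.Adj x b → PLink G x a b A → x ∉ A := by
      rintro a b A ha hb (⟨-, rfl⟩ | ⟨z, hz, -, -, rfl⟩)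
      · simp [ha.ne, hb.ne]
      · simp [ha.ne, hb.ne, hz.symm]
    refine ext_noncross (f x) r hrpos KA KB rA rB ?_ (q a0) (q a1) (q b0) (q b1) jA jB
      (hT _ ha0).2.1 (hT _ ha1).2.1 (hT _ hb0).2.1 (hT _ hb1).2.1 h1 h2 h3
    rw [Set.disjoint_left]
    intro p hp hp'
    exact hmeet A B (hxL _ _ _ ha0 ha1 hA) (hxL _ _ _ hb0 hb1 hB) hdisj p (rA p hp)
      (cA p hp) (cB p hp')

section Curvature

theorem lip_of_adj {V : Type*} (G : SimpleGraph V) (hconn : G.Connected) (f : V → ℝ)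
    (hf : ∀ a b, G.Adj a b → f b - f a ≤ 1) (a b : V) : f b - f a ≤ (G.dist a b : ℝ) := by
  obtain ⟨p, hp⟩ := hconn.exists_walk_length_eq_dist a b
  rw [← hp]
  clear hp
  induction p with
  | nil => simp
  | cons h p ih =>
    have := hf _ _ h
    simp only [SimpleGraph.Walk.length_cons]
    push_cast
    linarith

theorem sum_lazyWalk {V : Type*} (G : SimpleGraph V) [G.LocallyFinite] (α : ℝ) (x : V)
    (f : V → ℝ) (S : Finset V) (hx : x ∈ S) (hS : G.neighborFinset x ⊆ S) :
    ∑ v ∈ S, f v * lazyWalk G α x v =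
      α * f x + (1 - α) / (G.degree x : ℝ) * ∑ v ∈ G.neighborFinset x, f v := by
  classical
  have hxn : x ∉ G.neighborFinset x := by simp
  have hsub : insert x (G.neighborFinset x) ⊆ S := Finset.insert_subset hx hS
  rw [← Finset.sum_subset hsub, Finset.sum_insert hxn]
  · congr 1
    · simp [lazyWalk, mul_comm]
    · rw [Finset.mul_sum]
      apply Finset.sum_congr rfl
      intro v hv
      have hadj : G.Adj x v := (G.mem_neighborFinset _ _).1 hv
      simp only [lazyWalk, if_neg hadj.ne', if_pos hadj]
      ring
  · intro v _ hv
    simp only [Finset.mem_insert, SimpleGraph.mem_neighborFinset, not_or] at hv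
    simp [lazyWalk, hv.1, hv.2]

theorem lazyWalk_nonneg {V : Type*} (G : SimpleGraph V) [G.LocallyFinite] (α : ℝ)
    (h0 : 0 ≤ α) (h1 : α ≤ 1) (x v : V) : 0 ≤ lazyWalk G α x v := by
  unfold lazyWalk
  split_ifs
  · exact h0
  · exact div_nonneg (by linarith) (by positivity)
  · exact le_rfl

theorem lazyWalk_support {V : Type*} (G : SimpleGraph V) [G.LocallyFinite] (α : ℝ) (x : V)
    (S : Finset V) (hx : x ∈ S) (hS : G.neighborFinset x ⊆ S) :
    Function.support (lazyWalk G α x) ⊆ S := by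
  intro v hv
  by_contra hvS
  apply hv
  have h1 : v ≠ x := fun h => hvS (h ▸ hx)
  have h2 : ¬ G.Adj x v := fun h => hvS (hS ((G.mem_neighborFinset _ _).2 h))
  simp [lazyWalk, h1, h2]

theorem lazyWalk_sum_one {V : Type*} (G : SimpleGraph V) [G.LocallyFinite] (α : ℝ) (x : V)
    (hd : 0 < G.degree x)
    (S : Finset V) (hx : x ∈ S) (hS : G.neighborFinset x ⊆ S) :
    ∑ v ∈ S, lazyWalk G α x v = 1 := by
  have := sum_lazyWalk G α x (fun _ => 1) S hx hS
  simp only [one_mul] at this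
  rw [this]
  have hd' : (G.degree x : ℝ) ≠ 0 := by positivity
  simp
  field_simp
  ring

theorem exists_coupling {V : Type*} (m₁ m₂ : V → ℝ) (S : Finset V)
    (h1 : ∀ v, 0 ≤ m₁ v) (h2 : ∀ v, 0 ≤ m₂ v) (s1 : Function.support m₁ ⊆ S)
    (s2 : Function.support m₂ ⊆ S) (t1 : ∑ v ∈ S, m₁ v = 1) (t2 : ∑ v ∈ S, m₂ v = 1) :
    IsCoupling m₁ m₂ (fun a b => m₁ a * m₂ b) := by
  have le1 : ∀ (m : V → ℝ), (∀ v, 0 ≤ m v) → Function.support m ⊆ S → ∑ v ∈ S, m v = 1 →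
      ∀ v, m v ≤ 1 := by
    intro m hm hs ht v
    by_cases hv : v ∈ S
    · rw [← ht]; exact Finset.single_le_sum (fun i _ => hm i) hv
    · have : m v = 0 := by
        by_contra h; exact hv (hs h)
      rw [this]; exact zero_le_one
  refine ⟨?_, ?_, ?_, ?_⟩
  · apply Set.Finite.subset (S ×ˢ S).finite_toSet
    rintro ⟨a, b⟩ hab
    simp only [Function.mem_support] at hab
    have ha := s1 (left_ne_zero_of_mul hab)
    have hb := s2 (right_ne_zero_of_mul hab)
    simpa using And.intro ha hb
  · intro a b
    exact ⟨mul_nonneg (h1 a) (h2 b), mul_le_one₀ (le1 _ h1 s1 t1 a) (h2 b) (le1 _ h2 s2 t2 b)⟩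
  · intro a
    rw [finsum_eq_sum_of_support_subset (s := S), ← Finset.mul_sum, t2, mul_one]
    intro b hb
    exact s2 (right_ne_zero_of_mul hb)
  · intro b
    rw [finsum_eq_sum_of_support_subset (s := S), ← Finset.sum_mul, t1, one_mul]
    intro a ha
    exact s1 (left_ne_zero_of_mul ha)

/-- Weak Kantorovich duality. -/
theorem coupling_cost {V : Type*} (G : SimpleGraph V) (m₁ m₂ : V → ℝ) (A : V → V → ℝ)
    (hA : IsCoupling m₁ m₂ A) (f : V → ℝ) (hf : ∀ a b, f b - f a ≤ (G.dist a b : ℝ))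
    (S : Finset V) :
    ∃ S' : Finset V, S ⊆ S' ∧ ∑ v ∈ S', f v * m₂ v - ∑ v ∈ S', f v * m₁ v ≤
      ∑ᶠ p : V × V, A p.1 p.2 * (G.dist p.1 p.2 : ℝ) := by
  classical
  obtain ⟨hfin, hnn, hr, hc⟩ := hA
  set S' : Finset V := S ∪ hfin.toFinset.image Prod.fst ∪ hfin.toFinset.image Prod.snd with hS'
  have hmem : ∀ a b, A a b ≠ 0 → a ∈ S' ∧ b ∈ S' := by
    intro a b hab
    have hm : (a, b) ∈ hfin.toFinset := by simpa using hab
    constructor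
    · exact Finset.mem_union_left _ (Finset.mem_union_right _ (Finset.mem_image_of_mem Prod.fst hm))
    · exact Finset.mem_union_right _ (Finset.mem_image_of_mem Prod.snd hm)
  refine ⟨S', fun v hv => Finset.mem_union_left _ (Finset.mem_union_left _ hv), ?_⟩
  rw [finsum_eq_sum_of_support_subset (s := S' ×ˢ S')]
  · have e1 : ∀ v, m₁ v = ∑ b ∈ S', A v b := by
      intro v
      rw [← hr v]
      apply finsum_eq_sum_of_support_subset
      intro b hb
      exact (hmem v b hb).2
    have e2 : ∀ v, m₂ v = ∑ a ∈ S', A a v := by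
      intro v
      rw [← hc v]
      apply finsum_eq_sum_of_support_subset
      intro a ha
      exact (hmem a v ha).1
    rw [Finset.sum_product]
    have h2 : ∑ v ∈ S', f v * m₂ v = ∑ a ∈ S', ∑ b ∈ S', f b * A a b := by
      rw [Finset.sum_comm]
      apply Finset.sum_congr rfl
      intro v _
      rw [e2, Finset.mul_sum]
    have h1 : ∑ v ∈ S', f v * m₁ v = ∑ a ∈ S', ∑ b ∈ S', f a * A a b := by
      apply Finset.sum_congr rfl
      intro v _
      rw [e1, Finset.mul_sum]
    rw [h1, h2, ← Finset.sum_sub_distrib]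
    apply Finset.sum_le_sum
    intro a _
    rw [← Finset.sum_sub_distrib]
    apply Finset.sum_le_sum
    intro b _
    have := mul_le_mul_of_nonneg_left (hf a b) (hnn a b).1
    simp only
    linarith
  · rintro ⟨a, b⟩ hab
    have := hmem a b (left_ne_zero_of_mul hab)
    simpa using this

theorem curv_test {V : Type*} (G : SimpleGraph V) [G.LocallyFinite] (hconn : G.Connected)
    (x y : V) (hxy : G.Adj x y) (κ : ℝ) (hκ : 0 < κ) (hc : HasLLYCurv G x y κ)
    (f : V → ℝ) (hf : ∀ a b, G.Adj a b → f b - f a ≤ 1) (hfx : f x = 0) (hfy : f y = 1) :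
    0 < 1 - (∑ w ∈ G.neighborFinset y, f w) / (G.degree y : ℝ)
      + (∑ u ∈ G.neighborFinset x, f u) / (G.degree x : ℝ) := by
  classical
  have hlip := lip_of_adj G hconn f hf
  refine lt_of_lt_of_le hκ ?_
  refine le_of_tendsto hc ?_
  have hmem : Set.Ioo (0:ℝ) 1 ∈ nhdsWithin (1:ℝ) (Set.Iio 1) := Ioo_mem_nhdsLT zero_lt_one
  filter_upwards [hmem] with α hα
  obtain ⟨hα0, hα1⟩ := hα
  have hpos : 0 < 1 - α := by linarith
  rw [div_le_iff₀ hpos]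
  unfold alphaRicci
  have hdist : (G.dist x y : ℝ) = 1 := by
    rw [SimpleGraph.dist_eq_one_iff_adj.2 hxy]; simp
  rw [hdist, div_one]
  have hdx : 0 < G.degree x := (G.degree_pos_iff_exists_adj x).2 ⟨y, hxy⟩
  have hdy : 0 < G.degree y := (G.degree_pos_iff_exists_adj y).2 ⟨x, hxy.symm⟩
  set S0 : Finset V := insert x (G.neighborFinset x) ∪ insert y (G.neighborFinset y) with hS0
  have x1 : x ∈ S0 := by simp [hS0]
  have y1 : y ∈ S0 := by simp [hS0]
  have x2 : G.neighborFinset x ⊆ S0 := fun v hv =>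
    Finset.mem_union_left _ (Finset.mem_insert_of_mem hv)
  have y2 : G.neighborFinset y ⊆ S0 := fun v hv =>
    Finset.mem_union_right _ (Finset.mem_insert_of_mem hv)
  have hW : α + (1 - α) * ((∑ w ∈ G.neighborFinset y, f w) / (G.degree y : ℝ)
      - (∑ u ∈ G.neighborFinset x, f u) / (G.degree x : ℝ)) ≤
      transportDist G (lazyWalk G α x) (lazyWalk G α y) := by
    unfold transportDist
    apply le_csInf
    · exact ⟨_, _, exists_coupling (lazyWalk G α x) (lazyWalk G α y) S0
        (lazyWalk_nonneg G α hα0.le hα1.le x) (lazyWalk_nonneg G α hα0.le hα1.le y)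
        (lazyWalk_support G α x S0 x1 x2) (lazyWalk_support G α y S0 y1 y2)
        (lazyWalk_sum_one G α x hdx S0 x1 x2) (lazyWalk_sum_one G α y hdy S0 y1 y2), rfl⟩
    · rintro w ⟨A, hA, rfl⟩
      obtain ⟨S', hS', hle⟩ := coupling_cost G _ _ A hA f hlip S0
      rw [sum_lazyWalk G α y f S' (hS' y1) (y2.trans hS'),
        sum_lazyWalk G α x f S' (hS' x1) (x2.trans hS'), hfx, hfy] at hle
      refine le_trans (le_of_eq ?_) hle
      ring
  linarith [hW]

/-- The combinatorial inequality that positive curvature forces on an edge `xy`. -/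
theorem curv_count {V : Type*} [DecidableEq V] (G : SimpleGraph V) [G.LocallyFinite]
    (hconn : G.Connected) (hpos : PositivelyCurved G) (x y : V) (hxy : G.Adj x y)
    (D S : Finset V) (hD : ∀ w ∈ D, G.Adj y w ∧ w ≠ x)
    (hS : ∀ w ∈ D, ∀ u, G.Adj w u → G.Adj x u → u ≠ y → ¬ G.Adj y u → u ∈ S) :
    G.degree x * D.card < G.degree y *
      (2 + (G.neighborFinset x ∩ G.neighborFinset y).card + S.card +
        (D ∩ G.neighborFinset x).card) := by
  classical
  obtain ⟨κ, hκ, hc⟩ := hpos hxy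
  -- the test function
  set f : V → ℝ := fun v => if v = y ∨ v ∈ D then 1 else
    if G.Adj x v ∧ ¬ G.Adj y v ∧ v ∉ S then -1 else 0 with hf
  have hxD : x ∉ D := fun h => (hD x h).2 rfl
  have hyD : y ∉ D := fun h => (hD y h).1.ne rfl
  have hlip : ∀ a b, G.Adj a b → f b - f a ≤ 1 := by
    intro a b hab
    simp only [hf]
    by_cases hb : b = y ∨ b ∈ D
    · rw [if_pos hb]
      by_cases ha : a = y ∨ a ∈ D
      · rw [if_pos ha]; norm_num
      · rw [if_neg ha]
        rw [if_neg]
        · norm_num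
        · rintro ⟨h1, h2, h3⟩
          push Not at ha
          rcases hb with rfl | hb
          · exact h2 hab.symm
          · exact h3 (hS b hb a hab.symm h1 ha.1 h2)
    · rw [if_neg hb]
      split_ifs <;> norm_num
  have hfx : f x = 0 := by
    simp only [hf]
    rw [if_neg, if_neg]
    · simp
    · rintro (h | h)
      · exact hxy.ne h
      · exact hxD h
  have hfy : f y = 1 := by simp [hf]
  have key := curv_test G hconn x y hxy κ hκ hc f hlip hfx hfy
  set N := G.neighborFinset y with hN
  set P := G.neighborFinset x with hP
  have hyP : y ∈ P := (G.mem_neighborFinset _ _).2 hxy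
  have hDN : D ⊆ N := fun w hw => (G.mem_neighborFinset _ _).2 (hD w hw).1
  have sumN : (D.card : ℝ) ≤ ∑ w ∈ N, f w := by
    have : ∑ w ∈ N, (if w ∈ D then (1:ℝ) else 0) ≤ ∑ w ∈ N, f w := by
      apply Finset.sum_le_sum
      intro w hw
      have hyw : G.Adj y w := (G.mem_neighborFinset _ _).1 hw
      simp only [hf]
      by_cases hwD : w ∈ D
      · simp [hwD]
      · rw [if_neg hwD, if_neg, if_neg]
        · exact fun h => h.2.1 hyw
        · rintro (h | h)
          · exact hyw.ne h.symm
          · exact hwD h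
    refine le_trans (le_of_eq ?_) this
    rw [Finset.sum_ite_mem, Finset.inter_eq_right.2 hDN]
    simp
  have sumP : ∑ u ∈ P, f u ≤ 2 + ((P ∩ N).card : ℝ) + S.card + (D ∩ P).card - P.card := by
    have : ∑ u ∈ P, f u ≤ ∑ u ∈ P, ((if u = y then (2:ℝ) else 0) + (if u ∈ N then (1:ℝ) else 0)
        + (if u ∈ S then (1:ℝ) else 0) + (if u ∈ D then (1:ℝ) else 0) - 1) := by
      apply Finset.sum_le_sum
      intro u hu
      have hxu : G.Adj x u := (G.mem_neighborFinset _ _).1 hu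
      have hNu : G.Adj y u ↔ u ∈ N := (G.mem_neighborFinset _ _).symm
      simp only [hf]
      by_cases h1 : u = y
      · subst h1
        simp only [true_or, if_true]
        split_ifs <;> norm_num
      · by_cases h2 : u ∈ D
        · have := hDN h2
          simp only [h1, h2, this, or_true, if_true, if_false]
          split_ifs <;> norm_num
        · rw [if_neg (by rintro (h | h); exacts [h1 h, h2 h]), if_neg h1, if_neg h2]
          by_cases h3 : u ∈ N
          · rw [if_neg (fun h => h.2.1 (hNu.2 h3)), if_pos h3]
            split_ifs <;> norm_num
          · rw [if_neg h3]
            by_cases h4 : u ∈ S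
            · rw [if_neg (fun h => h.2.2 h4), if_pos h4]; norm_num
            · rw [if_pos ⟨hxu, fun h => h3 (hNu.1 h), h4⟩, if_neg h4]; norm_num
    refine le_trans this (le_of_eq_of_le ?_ (le_refl
      (2 + ((P ∩ N).card : ℝ) + (P ∩ S).card + (D ∩ P).card - P.card)) |>.trans ?_)
    · rw [Finset.sum_sub_distrib, Finset.sum_add_distrib, Finset.sum_add_distrib,
        Finset.sum_add_distrib, Finset.sum_ite_mem, Finset.sum_ite_mem, Finset.sum_ite_mem,
        Finset.sum_ite_eq' P y, if_pos hyP, Finset.inter_comm D P]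
      rw [Finset.sum_const, Finset.sum_const, Finset.sum_const, Finset.sum_const,
        nsmul_eq_mul, nsmul_eq_mul, nsmul_eq_mul, nsmul_eq_mul, mul_one, mul_one, mul_one, mul_one]
    · have : ((P ∩ S).card : ℝ) ≤ S.card := by
        exact_mod_cast Finset.card_le_card Finset.inter_subset_right
      linarith
  have hPc : (P.card : ℝ) = G.degree x := by simp [hP]
  have hdx : (0:ℝ) < G.degree x := by
    exact_mod_cast (G.degree_pos_iff_exists_adj x).2 ⟨y, hxy⟩
  have hdy : (0:ℝ) < G.degree y := by
    exact_mod_cast (G.degree_pos_iff_exists_adj y).2 ⟨x, hxy.symm⟩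
  have k2 : (D.card : ℝ) / G.degree y <
      (2 + ((P ∩ N).card : ℝ) + S.card + (D ∩ P).card) / G.degree x := by
    have h1 : (D.card : ℝ) / G.degree y ≤ (∑ w ∈ N, f w) / (G.degree y : ℝ) := by gcongr
    have h2 : (∑ u ∈ P, f u) / (G.degree x : ℝ) ≤
      (2 + ((P ∩ N).card : ℝ) + S.card + (D ∩ P).card - G.degree x) / G.degree x := by
      rw [hPc] at sumP
      exact div_le_div_of_nonneg_right sumP hdx.le
    rw [sub_div, div_self hdx.ne'] at h2
    linarith
  rw [div_lt_div_iff₀ hdy hdx] at k2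
  have k3 : ((D.card * G.degree x : ℕ) : ℝ) <
    ((2 + (P ∩ N).card + S.card + (D ∩ P).card) * G.degree y : ℕ) := by
    push_cast; exact k2
  have k4 := Nat.cast_lt.1 k3
  rw [mul_comm (G.degree x), mul_comm (G.degree y)]
  exact k4

end Curvature

section Cyclic

/-- A cyclic enumeration of the neighbours of `x`, together with the non-crossing property
and the counting inequality coming from positive curvature. -/
structure CycSetup {V : Type*} [DecidableEq V] (G : SimpleGraph V) [G.LocallyFinite] (x : V)
    (p : ℤ → V) (t : ℤ) : Prop where
  ht : 18 ≤ t
  adj : ∀ i, G.Adj x (p i)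
  surj : ∀ u, G.Adj x u → ∀ i : ℤ, ∃ l, i ≤ l ∧ l < i + t ∧ p l = u
  inj : ∀ i j : ℤ, p i = p j → i < j + t → j < i + t → i = j
  per : ∀ i, p (i + t) = p i
  nc : ∀ i m j l : ℤ, i < m → m < j → j < l → l < i + t → ∀ A B : Set V,
    PLink G x (p i) (p j) A → PLink G x (p m) (p l) B → Disjoint A B → False
  mind : ∀ u, 3 ≤ G.degree u
  curv : ∀ y, G.Adj x y → ∀ D S : Finset V, (∀ w ∈ D, G.Adj y w ∧ w ≠ x) →
    (∀ w ∈ D, ∀ u, G.Adj w u → G.Adj x u → u ≠ y → ¬ G.Adj y u → u ∈ S) →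
    18 * D.card < G.degree y * (2 + (G.neighborFinset x ∩ G.neighborFinset y).card + S.card +
        (D ∩ G.neighborFinset x).card)

theorem exists_cyc {V : Type*} [DecidableEq V] (G : SimpleGraph V) [G.LocallyFinite]
    (hconn : G.Connected) (hplanar : IsPlanar G)
    (hmin : ∀ u : V, 3 ≤ G.degree u) (hpos : PositivelyCurved G)
    (x : V) (hdx : 18 ≤ G.degree x) : ∃ p : ℤ → V, CycSetup G x p (G.degree x : ℤ) := by
  obtain ⟨θ, hinj, hnc⟩ := exists_angle G hplanar x
  have hinjOn : Set.InjOn θ (G.neighborFinset x : Set V) := by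
    intro a ha b hb hab
    exact hinj a b (by simpa using ha) (by simpa using hb) hab
  have hcard : ((G.neighborFinset x).image θ).card = G.degree x := by
    rw [Finset.card_image_of_injOn hinjOn, G.card_neighborFinset_eq_degree]
  set o := ((G.neighborFinset x).image θ).orderEmbOfFin hcard with ho
  have hq : ∀ k : Fin (G.degree x), ∃ u, G.Adj x u ∧ θ u = o k := by
    intro k
    have := Finset.orderEmbOfFin_mem ((G.neighborFinset x).image θ) hcard k
    obtain ⟨u, hu, h⟩ := Finset.mem_image.1 this
    exact ⟨u, by simpa using hu, h⟩
  choose q hqa hqo using hq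
  have hqs : ∀ u, G.Adj x u → ∃ k, q k = u := by
    intro u hu
    have : θ u ∈ Set.range o := by
      rw [ho, Finset.range_orderEmbOfFin]
      simp only [Finset.coe_image, Set.mem_image, Finset.mem_coe]
      exact ⟨u, by simpa using hu, rfl⟩
    obtain ⟨k, hk⟩ := this
    exact ⟨k, hinj _ _ (hqa k) hu (by rw [hqo, hk])⟩
  set t : ℤ := (G.degree x : ℤ) with ht
  have htpos : 0 < t := by omega
  have hb : ∀ i : ℤ, (i % t).toNat < G.degree x := by
    intro i
    have h1 := Int.emod_nonneg i htpos.ne'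
    have h2 := Int.emod_lt_of_pos i htpos
    omega
  set p : ℤ → V := fun i => q ⟨(i % t).toNat, hb i⟩ with hp
  have hpmod : ∀ i j : ℤ, i % t = j % t → p i = p j := by
    intro i j h
    simp only [hp, h]
  have hadj : ∀ i, G.Adj x (p i) := fun i => hqa _
  have hmono : ∀ a b : ℤ, 0 ≤ a → a < b → b < t → θ (p a) < θ (p b) := by
    intro a b h0 h1 h2
    simp only [hp, hqo]
    apply o.strictMono
    rw [Fin.mk_lt_mk, Int.emod_eq_of_lt h0 (by omega), Int.emod_eq_of_lt (by omega) h2]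
    omega
  have hper : ∀ i, p (i + t) = p i := fun i => hpmod _ _ (by simp)
  have hshift : ∀ i c : ℤ, p (i - c * t) = p i := fun i c => hpmod _ _ (by simp)
  have hnc' : ∀ i m j l : ℤ, 0 ≤ i → i < t → i < m → m < j → j < l → l < i + t → ∀ A B : Set V,
      PLink G x (p i) (p j) A → PLink G x (p m) (p l) B → Disjoint A B → False := by
    intro i m j l h0 h1 him hmj hjl hli A B hA hB hd
    have hper' : ∀ i, p i = p (i - t) := fun i => by rw [← hper (i - t)]; congr 1; ring
    by_cases hl : l < t
    · exact hnc _ _ _ _ A B (hadj i) (hadj j) (hadj m) (hadj l) hA hB hd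
        (hmono _ _ (by omega) (by omega) (by omega)) (hmono _ _ (by omega) (by omega) (by omega))
        (Or.inr (hmono _ _ (by omega) (by omega) (by omega)))
    rw [hper' l] at hB
    by_cases hj : j < t
    · exact hnc _ _ _ _ A B (hadj i) (hadj j) (hadj m) (hadj _) hA hB hd
        (hmono _ _ (by omega) (by omega) (by omega)) (hmono _ _ (by omega) (by omega) (by omega))
        (Or.inl (hmono _ _ (by omega) (by omega) (by omega)))
    rw [hper' j] at hA
    by_cases hm : m < t
    · exact hnc _ _ _ _ A B (hadj _) (hadj _) (hadj _) (hadj _) hA.symm hB.symm hd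
        (hmono _ _ (by omega) (by omega) (by omega)) (hmono _ _ (by omega) (by omega) (by omega))
        (Or.inr (hmono _ _ (by omega) (by omega) (by omega)))
    rw [hper' m] at hB
    exact hnc _ _ _ _ B A (hadj _) (hadj _) (hadj _) (hadj _) hB hA.symm hd.symm
        (hmono _ _ (by omega) (by omega) (by omega)) (hmono _ _ (by omega) (by omega) (by omega))
        (Or.inr (hmono _ _ (by omega) (by omega) (by omega)))
  refine ⟨p, ⟨by omega, hadj, ?_, ?_, hper, ?_, hmin, ?_⟩⟩
  · intro u hu i
    obtain ⟨k, rfl⟩ := hqs u hu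
    have h1 := Int.emod_nonneg ((k : ℤ) - i) htpos.ne'
    have h2 := Int.emod_lt_of_pos ((k : ℤ) - i) htpos
    refine ⟨i + ((k : ℤ) - i) % t, by omega, by omega, ?_⟩
    have e : (i + ((k : ℤ) - i) % t) % t = k := by
      rw [Int.add_emod_emod, add_sub_cancel, Int.emod_eq_of_lt (by omega) (by omega)]
    simp only [hp, e, Int.toNat_natCast]
  · intro i j hij h1 h2
    have e1 : θ (p i) = θ (p j) := by rw [hij]
    simp only [hp, hqo] at e1
    have e2 := o.injective e1
    rw [Fin.mk.injEq] at e2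
    have a1 := Int.emod_nonneg i htpos.ne'
    have a2 := Int.emod_nonneg j htpos.ne'
    have e3 : i % t = j % t := by omega
    obtain ⟨c, hc⟩ := Int.dvd_of_emod_eq_zero
      (Int.emod_eq_emod_iff_emod_sub_eq_zero.1 e3)
    have : c = 0 := by
      have b1 : -t < t * c := by omega
      have b2 : t * c < t := by omega
      have b3 : -1 < c := by nlinarith
      have b4 : c < 1 := by nlinarith
      omega
    subst this
    omega
  · intro i m j l him hmj hjl hli A B hA hB hd
    have h1 := Int.emod_nonneg i htpos.ne'
    have h2 := Int.emod_lt_of_pos i htpos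
    have h3 : i - (i / t) * t = i % t := by
      have := Int.mul_ediv_add_emod i t
      linarith
    set c := i / t
    refine hnc' (i - c * t) (m - c * t) (j - c * t) (l - c * t) (by omega) (by omega) (by omega)
      (by omega) (by omega) (by omega) A B ?_ ?_ hd
    · rwa [hshift, hshift]
    · rwa [hshift, hshift]
  · intro y hy D S hD hS
    have := curv_count G hconn hpos x y hy D S hD hS
    refine lt_of_le_of_lt ?_ this
    exact Nat.mul_le_mul_right _ hdx

end Cyclic

section Combi

namespace CycSetup

variable {V : Type*} [DecidableEq V] {G : SimpleGraph V} [G.LocallyFinite] {x : V}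
    {p : ℤ → V} {t : ℤ}

theorem ne' (h : CycSetup G x p t) {i j : ℤ} (h1 : i ≠ j) (h2 : i < j + t) (h3 : j < i + t) :
    p i ≠ p j := fun e => h1 (h.inj i j e h2 h3)

theorem hub_ne (h : CycSetup G x p t) {z : V} (hz : ¬ G.Adj x z) (i : ℤ) : p i ≠ z := by
  rintro rfl
  exact hz (h.adj i)

/-- chord against chord -/
theorem cc (h : CycSetup G x p t) {i m j l : ℤ} (him : i < m) (hmj : m < j) (hji : j < i + t)
    (hc : G.Adj (p i) (p j)) (hl : l < i + t) (hml : G.Adj (p m) (p l)) : l ≤ j := by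
  by_contra hcon
  push Not at hcon
  refine h.nc i m j l him hmj hcon hl {p i, p j} {p m, p l} (Or.inl ⟨hc, rfl⟩)
    (Or.inl ⟨hml, rfl⟩) ?_
  rw [Set.disjoint_left]
  rintro u (rfl | rfl) (e | e)
  · exact h.ne' (by omega) (by omega) (by omega) e
  · exact h.ne' (by omega) (by omega) (by omega) e
  · exact h.ne' (by omega) (by omega) (by omega) e
  · exact h.ne' (by omega) (by omega) (by omega) e

/-- chord against hub -/
theorem ch (h : CycSetup G x p t) {i m j l : ℤ} (him : i < m) (hmj : m < j) (hji : j < i + t)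
    (hc : G.Adj (p i) (p j)) (hl : l < i + t) {w : V} (hw : ¬ G.Adj x w) (hwx : w ≠ x)
    (h1 : G.Adj (p m) w) (h2 : G.Adj (p l) w) : l ≤ j := by
  by_contra hcon
  push Not at hcon
  refine h.nc i m j l him hmj hcon hl {p i, p j} {p m, w, p l} (Or.inl ⟨hc, rfl⟩)
    (Or.inr ⟨w, hwx, h1, h2, rfl⟩) ?_
  rw [Set.disjoint_left]
  rintro u (rfl | rfl) (e | e | e)
  · exact h.ne' (by omega) (by omega) (by omega) e
  · exact h.hub_ne hw _ e
  · exact h.ne' (by omega) (by omega) (by omega) e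
  · exact h.ne' (by omega) (by omega) (by omega) e
  · exact h.hub_ne hw _ e
  · exact h.ne' (by omega) (by omega) (by omega) e

/-- hub against hub -/
theorem hh (h : CycSetup G x p t) {i m j l : ℤ} (him : i < m) (hmj : m < j) (hji : j < i + t)
    {z : V} (hz : ¬ G.Adj x z) (hzx : z ≠ x) (hz1 : G.Adj (p i) z) (hz2 : G.Adj (p j) z)
    (hl : l < i + t) {w : V} (hw : ¬ G.Adj x w) (hwx : w ≠ x) (hwz : w ≠ z)
    (h1 : G.Adj (p m) w) (h2 : G.Adj (p l) w) : l ≤ j := by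
  by_contra hcon
  push Not at hcon
  refine h.nc i m j l him hmj hcon hl {p i, z, p j} {p m, w, p l}
    (Or.inr ⟨z, hzx, hz1, hz2, rfl⟩) (Or.inr ⟨w, hwx, h1, h2, rfl⟩) ?_
  rw [Set.disjoint_left]
  rintro u (rfl | rfl | rfl) (e | e | e)
  · exact h.ne' (by omega) (by omega) (by omega) e
  · exact h.hub_ne hw _ e
  · exact h.ne' (by omega) (by omega) (by omega) e
  · exact h.hub_ne hz _ e.symm
  · exact hwz e.symm
  · exact h.hub_ne hz _ e.symm
  · exact h.ne' (by omega) (by omega) (by omega) e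
  · exact h.hub_ne hw _ e
  · exact h.ne' (by omega) (by omega) (by omega) e

/-- The counting inequality, with the neighbours of `p m` split in three groups. -/
theorem key (h : CycSetup G x p t) (m : ℤ) : ∃ R C : Finset V,
    (∀ w, w ∈ R ↔ G.Adj (p m) w ∧ w ≠ x ∧ ¬ G.Adj x w) ∧
    (∀ u, u ∈ C ↔ G.Adj x u ∧ G.Adj (p m) u) ∧ 2 ≤ C.card + R.card ∧
    ∀ R' ⊆ R, ∀ C' ⊆ C, ∀ S : Finset V,
      (∀ w ∈ R', ∀ u, G.Adj w u → G.Adj x u → u ≠ p m → ¬ G.Adj (p m) u → u ∈ S) →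
      (∀ w ∈ C', ∀ u, G.Adj w u → G.Adj x u → u ≠ p m → ¬ G.Adj (p m) u → u ∈ S) →
      18 * (R'.card + C'.card) < (1 + C.card + R.card) * (2 + C.card + S.card + C'.card) := by
  set y := p m with hy
  have hxy : G.Adj x y := h.adj m
  set C := G.neighborFinset x ∩ G.neighborFinset y with hC
  set R := (G.neighborFinset y \ C).erase x with hR
  have mC : ∀ u, u ∈ C ↔ G.Adj x u ∧ G.Adj y u := by intro u; simp [hC]
  have mR : ∀ w, w ∈ R ↔ G.Adj y w ∧ w ≠ x ∧ ¬ G.Adj x w := by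
    intro w; simp only [hR, Finset.mem_erase, Finset.mem_sdiff, mC, G.mem_neighborFinset]; tauto
  have hdeg : G.degree y = 1 + C.card + R.card := by
    have h1 : x ∈ G.neighborFinset y \ C := by
      simp only [Finset.mem_sdiff, mC, G.mem_neighborFinset]
      exact ⟨hxy.symm, fun hh => hh.1.ne rfl⟩
    have h2 : R.card + 1 = (G.neighborFinset y \ C).card := Finset.card_erase_add_one h1
    have h3 : C ⊆ G.neighborFinset y := Finset.inter_subset_right
    have h4 := Finset.card_sdiff_add_card_eq_card h3
    rw [G.card_neighborFinset_eq_degree] at h4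
    omega
  refine ⟨R, C, mR, mC, ?_, ?_⟩
  · have := h.mind y
    omega
  · intro R' hR' C' hC' S hS1 hS2
    have hdisj : Disjoint R' C' := by
      rw [Finset.disjoint_left]
      intro w hw hw'
      exact ((mR w).1 (hR' hw)).2.2 ((mC w).1 (hC' hw')).1
    have := h.curv y hxy (R' ∪ C') S ?_ ?_
    · have e : (R' ∪ C') ∩ G.neighborFinset x = C' := by
        ext w
        simp only [Finset.mem_inter, Finset.mem_union, G.mem_neighborFinset]
        constructor
        · rintro ⟨hw | hw, hx⟩
          · exact absurd hx ((mR w).1 (hR' hw)).2.2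
          · exact hw
        · intro hw
          exact ⟨Or.inr hw, ((mC w).1 (hC' hw)).1⟩
      rw [e, Finset.card_union_of_disjoint hdisj, hdeg] at this
      exact this
    · intro w hw
      rcases Finset.mem_union.1 hw with hw | hw
      · have := (mR w).1 (hR' hw); exact ⟨this.1, this.2.1⟩
      · have := (mC w).1 (hC' hw); exact ⟨this.2, this.1.ne'⟩
    · intro w hw
      rcases Finset.mem_union.1 hw with hw | hw
      · exact hS1 w hw
      · exact hS2 w hw

theorem card2 (a b : V) : ({a, b} : Finset V).card ≤ 2 := Finset.card_le_two
theorem card3 (a b c : V) : ({a, b, c} : Finset V).card ≤ 3 := Finset.card_le_three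

/-- No hub over a stretch without long chords. -/
theorem noHub (h : CycSetup G x p t) (n : ℕ) : ∀ a b : ℤ, b - a = n → a + 2 ≤ b → b < a + t →
    ∀ z, ¬ G.Adj x z → z ≠ x → G.Adj (p a) z → G.Adj (p b) z →
    (∀ m, a ≤ m → m ≤ b → ∀ l, G.Adj (p m) (p l) → p l = p (m - 1) ∨ p l = p (m + 1)) → False := by
  induction n using Nat.strong_induction_on with
  | _ n ih =>
  intro a b hn hab hbt z hz hzx hza hzb hflat
  have ht := h.ht
  obtain ⟨R, C, mR, mC, hd, hK⟩ := h.key (a + 1)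
  have hw : ∀ w ∈ R.erase z, ∀ u, G.Adj w u → G.Adj x u → u ≠ p (a + 1) →
      u = p a ∨ u = p (a + 2) := by
    intro w hw u hwu hxu huy
    obtain ⟨hwz, hwR⟩ := Finset.mem_erase.1 hw
    obtain ⟨h1, h2, h3⟩ := (mR w).1 hwR
    obtain ⟨l, hl1, hl2, rfl⟩ := h.surj u hxu a
    have hlb := h.hh (i := a) (m := a + 1) (j := b) (l := l) (by omega) (by omega) hbt hz hzx
      hza hzb hl2 h3 h2 hwz h1 hwu.symm
    by_cases hl : l < a + 3
    · have : l = a ∨ l = a + 1 ∨ l = a + 2 := by omega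
      rcases this with rfl | rfl | rfl
      · exact Or.inl rfl
      · exact absurd rfl huy
      · exact Or.inr rfl
    · exfalso
      refine ih (l - (a + 1)).toNat (by omega) (a + 1) l (by omega) (by omega) (by omega) w h3 h2
        h1 hwu.symm ?_
      intro m hm1 hm2
      exact hflat m (by omega) (by omega)
  have hCs : ∀ u ∈ C, u = p a ∨ u = p (a + 2) := by
    intro u hu
    obtain ⟨h1, h2⟩ := (mC u).1 hu
    obtain ⟨l, -, -, rfl⟩ := h.surj u h1 a
    rcases hflat (a + 1) (by omega) (by omega) l h2 with e | e
    · left; rw [e]; congr 1; ring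
    · right; rw [e]; congr 1; ring
  have hs : C.card ≤ 2 := by
    refine le_trans (Finset.card_le_card (t := {p a, p (a + 2)}) ?_) (card2 _ _)
    intro u hu
    simpa using hCs u hu
  have hR1 : R.card ≤ (R.erase z).card + 1 := by
    have := Finset.pred_card_le_card_erase (s := R) (a := z)
    omega
  have hxa := h.adj a
  have hxb := h.adj (a + 2)
  classical
  have hS := hK (R.erase z) (Finset.erase_subset _ _) C (Finset.Subset.refl _)
    {if G.Adj (p (a + 1)) (p a) then p (a - 1) else p a,
      if G.Adj (p (a + 1)) (p (a + 2)) then p (a + 3) else p (a + 2)} ?_ ?_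
  · have hc := card2 (if G.Adj (p (a + 1)) (p a) then p (a - 1) else p a)
      (if G.Adj (p (a + 1)) (p (a + 2)) then p (a + 3) else p (a + 2))
    set sc := Finset.card {if G.Adj (p (a + 1)) (p a) then p (a - 1) else p a,
      if G.Adj (p (a + 1)) (p (a + 2)) then p (a + 3) else p (a + 2)}
    generalize (R.erase z).card = r' at *
    generalize R.card = r at *
    generalize C.card = s at *
    have : (1 + s + r) * (2 + s + sc + s) ≤ (1 + s + r) * (2 + s + 2 + s) :=
      Nat.mul_le_mul_left _ (by omega)
    interval_cases s <;> omega
  · intro w hwR u hwu hxu huy hyu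
    rw [Finset.mem_insert, Finset.mem_singleton]
    rcases hw w hwR u hwu hxu huy with rfl | rfl
    · left; rw [if_neg hyu]
    · right; rw [if_neg hyu]
  · intro w hwC u hwu hxu huy hyu
    rw [Finset.mem_insert, Finset.mem_singleton]
    obtain ⟨l, -, -, rfl⟩ := h.surj u hxu a
    have hyw := ((mC w).1 hwC).2
    rcases hCs w hwC with rfl | rfl
    · left; rw [if_pos hyw]
      rcases hflat a (by omega) (by omega) l hwu with e | e
      · exact e
      · exact absurd e huy
    · right; rw [if_pos hyw]
      rcases hflat (a + 2) (by omega) (by omega) l hwu with e | e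
      · exact absurd (by rw [e]; congr 1; ring) huy
      · rw [e]; congr 1; ring

/-- No chord of length at least three over a flat stretch. -/
theorem noFlat (h : CycSetup G x p t) (i j : ℤ) (hij : i + 3 ≤ j) (hjt : j < i + t)
    (hc : G.Adj (p i) (p j))
    (hflat : ∀ m l, i ≤ m → m < l → l ≤ j → G.Adj (p m) (p l) → l = m + 1 ∨ (m = i ∧ l = j)) :
    False := by
  have ht := h.ht
  obtain ⟨R, C, mR, mC, hd, hK⟩ := h.key (i + 1)
  -- neighbours of interior vertices
  have hnb : ∀ m l, i < m → m < j → i ≤ l → l < i + t → G.Adj (p m) (p l) →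
      l = m - 1 ∨ l = m + 1 := by
    intro m l h1 h2 h3 h4 hml
    have h5 := h.cc h1 h2 hjt hc h4 hml
    rcases lt_trichotomy l m with hlm | hlm | hlm
    · rcases hflat l m h3 hlm h2.le hml.symm with e | e <;> omega
    · subst hlm; exact absurd rfl hml.ne
    · rcases hflat m l h1.le hlm h5 hml with e | e <;> omega
  have hnb' : ∀ m, i < m → m < j → ∀ l, G.Adj (p m) (p l) → p l = p (m - 1) ∨ p l = p (m + 1) := by
    intro m h1 h2 l hml
    obtain ⟨l', h3, h4, h5⟩ := h.surj (p l) (h.adj l) i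
    rw [← h5] at hml ⊢
    rcases hnb m l' h1 h2 h3 h4 hml with rfl | rfl
    · exact Or.inl rfl
    · exact Or.inr rfl
  have hw : ∀ w ∈ R, ∀ u, G.Adj w u → G.Adj x u → u ≠ p (i + 1) →
      u = p i ∨ u = p (i + 2) ∨ u = p j := by
    intro w hwR u hwu hxu huy
    obtain ⟨h1, h2, h3⟩ := (mR w).1 hwR
    obtain ⟨l, hl1, hl2, rfl⟩ := h.surj u hxu i
    have hlb := h.ch (i := i) (m := i + 1) (j := j) (l := l) (by omega) (by omega) hjt hc hl2
      h3 h2 h1 hwu.symm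
    by_cases hl : l < i + 3 ∨ l = j
    · have : l = i ∨ l = i + 1 ∨ l = i + 2 ∨ l = j := by omega
      rcases this with rfl | rfl | rfl | rfl
      · exact Or.inl rfl
      · exact absurd rfl huy
      · exact Or.inr (Or.inl rfl)
      · exact Or.inr (Or.inr rfl)
    · exfalso
      refine h.noHub (l - (i + 1)).toNat (i + 1) l (by omega) (by omega) (by omega) w h3 h2
        h1 hwu.symm ?_
      intro m hm1 hm2
      exact hnb' m (by omega) (by omega)
  have hCs : ∀ u ∈ C, u = p i ∨ u = p (i + 2) := by
    intro u hu
    obtain ⟨h1, h2⟩ := (mC u).1 hu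
    obtain ⟨l, -, -, rfl⟩ := h.surj u h1 i
    rcases hnb' (i + 1) (by omega) (by omega) l h2 with e | e
    · left; rw [e]; congr 1; ring
    · right; rw [e]; congr 1; ring
  have hbn : ∀ u, G.Adj (p (i + 2)) u → G.Adj x u → u ≠ p (i + 1) → u = p (i + 3) := by
    intro u h1 h2 h3
    obtain ⟨l, -, -, rfl⟩ := h.surj u h2 i
    rcases hnb' (i + 2) (by omega) (by omega) l h1 with e | e
    · exact absurd (by rw [e]; congr 1; ring) h3
    · rw [e]; congr 1; ring
  have hab : p i ≠ p (i + 2) := h.ne' (by omega) (by omega) (by omega)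
  by_cases ha : G.Adj (p (i + 1)) (p i) <;> by_cases hb : G.Adj (p (i + 1)) (p (i + 2))
  · have hC : C = {p i, p (i + 2)} := by
      ext u
      rw [Finset.mem_insert, Finset.mem_singleton]
      refine ⟨hCs u, ?_⟩
      rintro (rfl | rfl)
      · exact (mC _).2 ⟨h.adj _, ha⟩
      · exact (mC _).2 ⟨h.adj _, hb⟩
    have hCc : C.card = 2 := by rw [hC]; exact Finset.card_pair hab
    have hsub : {p (i + 2)} ⊆ C := by rw [hC]; simp
    rcases Nat.eq_zero_or_pos R.card with hr | hr
    · have hR0 := Finset.card_eq_zero.1 hr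
      have := hK R (Finset.Subset.refl _) {p (i + 2)} hsub {p (i + 3)}
        (by intro w hwR; rw [hR0] at hwR; simp at hwR)
        (by
          intro w hwC u hwu hxu huy hyu
          rw [Finset.mem_singleton] at hwC ⊢
          subst hwC
          exact hbn u hwu hxu huy)
      rw [hCc, hr, Finset.card_singleton, Finset.card_singleton] at this
      omega
    · have := hK R (Finset.Subset.refl _) {p (i + 2)} hsub {p j, p (i + 3)}
        (by
          intro w hwR u hwu hxu huy hyu
          rw [Finset.mem_insert]
          rcases hw w hwR u hwu hxu huy with rfl | rfl | rfl
          · exact absurd ha hyu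
          · exact absurd hb hyu
          · exact Or.inl rfl)
        (by
          intro w hwC u hwu hxu huy hyu
          rw [Finset.mem_singleton] at hwC
          rw [Finset.mem_insert, Finset.mem_singleton]
          subst hwC
          exact Or.inr (hbn u hwu hxu huy))
      have hS := card2 (p j) (p (i + 3))
      rw [hCc, Finset.card_singleton] at this
      nlinarith
  · have hC : C = {p i} := by
      ext u
      rw [Finset.mem_singleton]
      constructor
      · intro hu
        rcases hCs u hu with rfl | rfl
        · rfl
        · exact absurd ((mC _).1 hu).2 hb
      · rintro rfl
        exact (mC _).2 ⟨h.adj _, ha⟩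
    have hCc : C.card = 1 := by rw [hC]; simp
    have := hK R (Finset.Subset.refl _) ∅ (by simp) {p (i + 2), p j}
        (by
          intro w hwR u hwu hxu huy hyu
          rw [Finset.mem_insert, Finset.mem_singleton]
          rcases hw w hwR u hwu hxu huy with rfl | rfl | rfl
          · exact absurd ha hyu
          · exact Or.inl rfl
          · exact Or.inr rfl)
        (by simp)
    have hS := card2 (p (i + 2)) (p j)
    rw [hCc, Finset.card_empty] at this
    nlinarith
  · have hC : C = {p (i + 2)} := by
      ext u
      rw [Finset.mem_singleton]
      constructor
      · intro hu
        rcases hCs u hu with rfl | rfl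
        · exact absurd ((mC _).1 hu).2 ha
        · rfl
      · rintro rfl
        exact (mC _).2 ⟨h.adj _, hb⟩
    have hCc : C.card = 1 := by rw [hC]; simp
    have := hK R (Finset.Subset.refl _) C (Finset.Subset.refl _) {p i, p j, p (i + 3)}
        (by
          intro w hwR u hwu hxu huy hyu
          rw [Finset.mem_insert, Finset.mem_insert]
          rcases hw w hwR u hwu hxu huy with rfl | rfl | rfl
          · exact Or.inl rfl
          · exact absurd hb hyu
          · exact Or.inr (Or.inl rfl))
        (by
          intro w hwC u hwu hxu huy hyu
          rw [hC, Finset.mem_singleton] at hwC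
          rw [Finset.mem_insert, Finset.mem_insert, Finset.mem_singleton]
          subst hwC
          exact Or.inr (Or.inr (hbn u hwu hxu huy)))
    have hS := card3 (p i) (p j) (p (i + 3))
    rw [hCc] at this
    nlinarith
  · have hC : C = ∅ := by
      rw [Finset.eq_empty_iff_forall_notMem]
      intro u hu
      rcases hCs u hu with rfl | rfl
      · exact absurd ((mC _).1 hu).2 ha
      · exact absurd ((mC _).1 hu).2 hb
    have hCc : C.card = 0 := by rw [hC]; simp
    have := hK R (Finset.Subset.refl _) ∅ (by simp) {p i, p (i + 2), p j}
        (by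
          intro w hwR u hwu hxu huy hyu
          rw [Finset.mem_insert, Finset.mem_insert, Finset.mem_singleton]
          exact hw w hwR u hwu hxu huy)
        (by simp)
    have hS := card3 (p i) (p (i + 2)) (p j)
    rw [hCc, Finset.card_empty] at this
    nlinarith

/-- Ears: a chord of length two. -/
theorem ear (h : CycSetup G x p t) (i : ℤ) (hc : G.Adj (p i) (p (i + 2))) :
    (∀ S : Finset V, (∀ u, G.Adj x u → u ≠ p i → u ≠ p (i + 1) → u ≠ p (i + 2) →
      (G.Adj (p i) u ∨ G.Adj (p (i + 2)) u) → u ∈ S) → 7 ≤ S.card) ∧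
    (∀ S : Finset V, (∀ u, G.Adj x u → u ≠ p i → u ≠ p (i + 1) → u ≠ p (i + 2) →
      G.Adj (p i) u → u ∈ S) → 2 ≤ S.card) ∧
    (∀ S : Finset V, (∀ u, G.Adj x u → u ≠ p i → u ≠ p (i + 1) → u ≠ p (i + 2) →
      G.Adj (p (i + 2)) u → u ∈ S) → 2 ≤ S.card) := by
  have ht := h.ht
  obtain ⟨R, C, mR, mC, hd, hK⟩ := h.key (i + 1)
  have hw : ∀ w ∈ R, ∀ u, G.Adj w u → G.Adj x u → u ≠ p (i + 1) →
      u = p i ∨ u = p (i + 2) := by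
    intro w hwR u hwu hxu huy
    obtain ⟨h1, h2, h3⟩ := (mR w).1 hwR
    obtain ⟨l, hl1, hl2, rfl⟩ := h.surj u hxu i
    have hlb := h.ch (i := i) (m := i + 1) (j := i + 2) (l := l) (by omega) (by omega)
      (by omega) hc hl2 h3 h2 h1 hwu.symm
    have : l = i ∨ l = i + 1 ∨ l = i + 2 := by omega
    rcases this with rfl | rfl | rfl
    · exact Or.inl rfl
    · exact absurd rfl huy
    · exact Or.inr rfl
  have hCs : ∀ u ∈ C, u = p i ∨ u = p (i + 2) := by
    intro u hu
    obtain ⟨h1, h2⟩ := (mC u).1 hu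
    obtain ⟨l, hl1, hl2, rfl⟩ := h.surj u h1 i
    have hlb := h.cc (i := i) (m := i + 1) (j := i + 2) (l := l) (by omega) (by omega)
      (by omega) hc hl2 h2
    have : l = i ∨ l = i + 1 ∨ l = i + 2 := by omega
    rcases this with rfl | rfl | rfl
    · exact Or.inl rfl
    · exact absurd rfl h2.ne
    · exact Or.inr rfl
  have hab : p i ≠ p (i + 2) := h.ne' (by omega) (by omega) (by omega)
  have hC : p i ∈ C ∧ p (i + 2) ∈ C := by
    by_contra hcon
    have hone : ∃ b, ∀ u ∈ C, u = b := by
      by_cases ha : p i ∈ C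
      · refine ⟨p i, fun u hu => ?_⟩
        rcases hCs u hu with rfl | rfl
        · rfl
        · exact absurd ⟨ha, hu⟩ hcon
      · refine ⟨p (i + 2), fun u hu => ?_⟩
        rcases hCs u hu with rfl | rfl
        · exact absurd hu ha
        · rfl
    have hC1 : C.card ≤ 1 := by
      obtain ⟨b, hb⟩ := hone
      refine Finset.card_le_one.2 fun u hu v hv => ?_
      rw [hb u hu, hb v hv]
    have := hK R (Finset.Subset.refl _) ∅ (by simp) ({p i, p (i + 2)} \ C)
        (by
          intro w hwR u hwu hxu huy hyu
          rw [Finset.mem_sdiff, Finset.mem_insert, Finset.mem_singleton]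
          exact ⟨hw w hwR u hwu hxu huy, fun hu => hyu ((mC u).1 hu).2⟩)
        (by simp)
    have hsub : C ⊆ {p i, p (i + 2)} := by
      intro u hu
      rw [Finset.mem_insert, Finset.mem_singleton]
      exact hCs u hu
    have h2 := Finset.card_sdiff_add_card_eq_card hsub
    have h3 := card2 (p i) (p (i + 2))
    rw [Finset.card_empty] at this
    have h4 : 18 * R.card < (1 + C.card + R.card) * 4 := by
      refine lt_of_lt_of_le this (Nat.mul_le_mul_left _ ?_)
      omega
    omega
  have hCeq : C = {p i, p (i + 2)} := by
    ext u
    rw [Finset.mem_insert, Finset.mem_singleton]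
    refine ⟨hCs u, ?_⟩
    rintro (rfl | rfl)
    · exact hC.1
    · exact hC.2
  have hCc : C.card = 2 := by rw [hCeq]; exact Finset.card_pair hab
  have hne : ∀ u, ¬ G.Adj (p (i + 1)) u → u ≠ p i ∧ u ≠ p (i + 2) := by
    intro u hu
    constructor
    · rintro rfl; exact hu ((mC _).1 hC.1).2
    · rintro rfl; exact hu ((mC _).1 hC.2).2
  have hRS : ∀ S : Finset V, ∀ w ∈ R, ∀ u, G.Adj w u → G.Adj x u → u ≠ p (i + 1) →
      ¬ G.Adj (p (i + 1)) u → u ∈ S := by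
    intro S w hwR u hwu hxu huy hyu
    rcases hw w hwR u hwu hxu huy with e | e
    · exact absurd e (hne u hyu).1
    · exact absurd e (hne u hyu).2
  refine ⟨?_, ?_, ?_⟩
  · intro S hS
    have := hK R (Finset.Subset.refl _) C (Finset.Subset.refl _) S (hRS S) (by
      intro w hwC u hwu hxu huy hyu
      refine hS u hxu (hne u hyu).1 huy (hne u hyu).2 ?_
      rcases hCs w hwC with rfl | rfl
      · exact Or.inl hwu
      · exact Or.inr hwu)
    rw [hCc] at this
    by_contra hcon
    have : 18 * (R.card + 2) < (1 + 2 + R.card) * 12 :=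
      lt_of_lt_of_le this (Nat.mul_le_mul_left _ (by omega))
    omega
  · intro S hS
    have := hK R (Finset.Subset.refl _) {p i} (by simpa using hC.1) S (hRS S) (by
      intro w hwC u hwu hxu huy hyu
      rw [Finset.mem_singleton] at hwC
      subst hwC
      exact hS u hxu (hne u hyu).1 huy (hne u hyu).2 hwu)
    rw [hCc, Finset.card_singleton] at this
    by_contra hcon
    have : 18 * (R.card + 1) < (1 + 2 + R.card) * 6 :=
      lt_of_lt_of_le this (Nat.mul_le_mul_left _ (by omega))
    omega
  · intro S hS
    have := hK R (Finset.Subset.refl _) {p (i + 2)} (by simpa using hC.2) S (hRS S) (by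
      intro w hwC u hwu hxu huy hyu
      rw [Finset.mem_singleton] at hwC
      subst hwC
      exact hS u hxu (hne u hyu).1 huy (hne u hyu).2 hwu)
    rw [hCc, Finset.card_singleton] at this
    by_contra hcon
    have : 18 * (R.card + 1) < (1 + 2 + R.card) * 6 :=
      lt_of_lt_of_le this (Nat.mul_le_mul_left _ (by omega))
    omega

/-- The information carried by a chord of length four. -/
def Four (G : SimpleGraph V) (x : V) (p : ℤ → V) (i : ℤ) : Prop :=
  (∀ S : Finset V, (∀ u, G.Adj x u → (∀ k, i ≤ k → k ≤ i + 4 → u ≠ p k) → G.Adj (p i) u →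
    u ∈ S) → 5 ≤ S.card) ∧
  (∀ S : Finset V, (∀ u, G.Adj x u → (∀ k, i ≤ k → k ≤ i + 4 → u ≠ p k) → G.Adj (p (i + 4)) u →
    u ∈ S) → 5 ≤ S.card)

theorem chord_main (h : CycSetup G x p t) (n : ℕ) : ∀ i j : ℤ, j - i = n → i < j → j < i + t →
    G.Adj (p i) (p j) → j = i + 1 ∨ j = i + 2 ∨ (j = i + 4 ∧ Four G x p i) := by
  induction n using Nat.strong_induction_on with
  | _ n ih =>
  intro i j hn hij hjt hc
  have ht := h.ht
  by_cases hlen : j < i + 3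
  · omega
  have IH : ∀ a b, i ≤ a → a < b → b ≤ j → (i < a ∨ b < j) → G.Adj (p a) (p b) →
      b = a + 1 ∨ b = a + 2 ∨ (b = a + 4 ∧ Four G x p a) := by
    intro a b h1 h2 h3 h4 hab
    exact ih (b - a).toNat (by omega) a b (by omega) h2 (by omega) hab
  -- neighbours of interior vertices
  have hnb : ∀ m, i < m → m < j → ∀ u, G.Adj x u → G.Adj (p m) u →
      ∃ l, i ≤ l ∧ l ≤ j ∧ u = p l ∧ (l = m - 1 ∨ l = m - 2 ∨ l = m - 4 ∨ l = m + 1 ∨ l = m + 2 ∨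
        l = m + 4) ∧ ((l = m - 4 → Four G x p l) ∧ (l = m + 4 → Four G x p m)) := by
    intro m h1 h2 u hxu hu
    obtain ⟨l, h3, h4, rfl⟩ := h.surj u hxu i
    have h5 := h.cc h1 h2 hjt hc h4 hu
    refine ⟨l, h3, h5, rfl, ?_⟩
    rcases lt_trichotomy l m with hlm | hlm | hlm
    · rcases IH l m h3 hlm h2.le (Or.inr h2) hu.symm with e | e | ⟨e, e'⟩
      · omega
      · omega
      · exact ⟨by omega, fun _ => e', by omega⟩
    · subst hlm; exact absurd rfl hu.ne
    · rcases IH m l h1.le hlm h5 (Or.inl h1) hu with e | e | ⟨e, e'⟩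
      · omega
      · omega
      · exact ⟨by omega, by omega, fun _ => e'⟩
  -- no inner chord of length four
  have no4 : ∀ q, i ≤ q → q + 4 ≤ j → (i < q ∨ q + 4 < j) → ¬ Four G x p q := by
    intro q h1 h2 h3 hF
    rcases h3 with h3 | h3
    · have := hF.1 {p (q - 1), p (q - 2), p (q - 4)} ?_
      · have := card3 (p (q - 1)) (p (q - 2)) (p (q - 4))
        omega
      · intro u hxu hk hu
        obtain ⟨l, h4, h5, rfl, h6, -⟩ := hnb q h3 (by omega) u hxu hu
        simp only [Finset.mem_insert, Finset.mem_singleton]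
        have hl : ¬ (q ≤ l ∧ l ≤ q + 4) := fun hh => hk l hh.1 hh.2 rfl
        have : l = q - 1 ∨ l = q - 2 ∨ l = q - 4 := by omega
        rcases this with rfl | rfl | rfl <;> simp
    · have := hF.2 {p (q + 5), p (q + 6), p (q + 8)} ?_
      · have := card3 (p (q + 5)) (p (q + 6)) (p (q + 8))
        omega
      · intro u hxu hk hu
        obtain ⟨l, h4, h5, rfl, h6, -⟩ := hnb (q + 4) (by omega) h3 u hxu hu
        simp only [Finset.mem_insert, Finset.mem_singleton]
        have hl : ¬ (q ≤ l ∧ l ≤ q + 4) := fun hh => hk l hh.1 hh.2 rfl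
        have : l = q + 5 ∨ l = q + 6 ∨ l = q + 8 := by omega
        rcases this with rfl | rfl | rfl <;> simp
  have hnb2 : ∀ m, i < m → m < j → ∀ u, G.Adj x u → G.Adj (p m) u →
      ∃ l, i ≤ l ∧ l ≤ j ∧ u = p l ∧ (l = m - 1 ∨ l = m - 2 ∨ l = m + 1 ∨ l = m + 2) := by
    intro m h1 h2 u hxu hu
    obtain ⟨l, h3, h4, h5, h6, h7, h8⟩ := hnb m h1 h2 u hxu hu
    refine ⟨l, h3, h4, h5, ?_⟩
    by_cases e : l = m - 4
    · exact absurd (h7 e) (no4 l h3 (by omega) (by omega))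
    by_cases e' : l = m + 4
    · exact absurd (h8 e') (no4 m h1.le (by omega) (by omega))
    omega
  -- no ear with both ends inside
  have noear : ∀ a, i < a → a + 2 < j → ¬ G.Adj (p a) (p (a + 2)) := by
    intro a h1 h2 hE
    have := (h.ear a hE).1 ({p (a - 1), p (a - 2)} ∪ {p (a + 3), p (a + 4)}) ?_
    · have e1 := card2 (p (a - 1)) (p (a - 2))
      have e2 := card2 (p (a + 3)) (p (a + 4))
      have e3 := Finset.card_union_le {p (a - 1), p (a - 2)} {p (a + 3), p (a + 4)}
      omega
    · intro u hxu n1 n2 n3 hu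
      simp only [Finset.mem_union, Finset.mem_insert, Finset.mem_singleton]
      have : ∃ l, u = p l ∧ a - 2 ≤ l ∧ l ≤ a + 4 := by
        rcases hu with hu | hu
        · obtain ⟨l, -, -, h5, h6⟩ := hnb2 a h1 (by omega) u hxu hu
          exact ⟨l, h5, by omega, by omega⟩
        · obtain ⟨l, -, -, h5, h6⟩ := hnb2 (a + 2) (by omega) h2 u hxu hu
          exact ⟨l, h5, by omega, by omega⟩
      obtain ⟨l, rfl, h6, h7⟩ := this
      have : l = a - 2 ∨ l = a - 1 ∨ l = a ∨ l = a + 1 ∨ l = a + 2 ∨ l = a + 3 ∨ l = a + 4 := by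
        omega
      rcases this with rfl | rfl | rfl | rfl | rfl | rfl | rfl <;> simp at n1 n2 n3 ⊢
  -- two ears make up a chord of length four
  have fin : j = i + 4 → G.Adj (p i) (p (i + 2)) → G.Adj (p (i + 2)) (p (i + 4)) →
      j = i + 1 ∨ j = i + 2 ∨ (j = i + 4 ∧ Four G x p i) := by
    intro hj h1 h2
    refine Or.inr (Or.inr ⟨hj, ?_, ?_⟩)
    · intro S hS
      have := (h.ear i h1).1 (S ∪ {p (i + 3), p (i + 4)}) ?_
      · have e2 := card2 (p (i + 3)) (p (i + 4))
        have e3 := Finset.card_union_le S {p (i + 3), p (i + 4)}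
        omega
      · intro u hxu n1 n2 n3 hu
        simp only [Finset.mem_union, Finset.mem_insert, Finset.mem_singleton]
        by_cases hk : ∃ k, i ≤ k ∧ k ≤ i + 4 ∧ u = p k
        · obtain ⟨k, k1, k2, rfl⟩ := hk
          have : k = i ∨ k = i + 1 ∨ k = i + 2 ∨ k = i + 3 ∨ k = i + 4 := by omega
          rcases this with rfl | rfl | rfl | rfl | rfl <;> simp at n1 n2 n3 ⊢
        · rcases hu with hu | hu
          · exact Or.inl (hS u hxu (fun k k1 k2 e => hk ⟨k, k1, k2, e⟩) hu)
          · obtain ⟨l, l1, l2, l3, -⟩ := hnb2 (i + 2) (by omega) (by omega) u hxu hu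
            exact absurd ⟨l, l1, by omega, l3⟩ hk
    · intro S hS
      have h2' : G.Adj (p (i + 2)) (p (i + 2 + 2)) := by
        have : i + 2 + 2 = i + 4 := by ring
        rw [this]; exact h2
      have := (h.ear (i + 2) h2').1 (S ∪ {p i, p (i + 1)}) ?_
      · have e2 := card2 (p i) (p (i + 1))
        have e3 := Finset.card_union_le S {p i, p (i + 1)}
        omega
      · intro u hxu n1 n2 n3 hu
        have e1 : i + 2 + 1 = i + 3 := by ring
        have e2 : i + 2 + 2 = i + 4 := by ring
        rw [e1] at n2
        rw [e2] at n3 hu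
        simp only [Finset.mem_union, Finset.mem_insert, Finset.mem_singleton]
        by_cases hk : ∃ k, i ≤ k ∧ k ≤ i + 4 ∧ u = p k
        · obtain ⟨k, k1, k2, rfl⟩ := hk
          have : k = i ∨ k = i + 1 ∨ k = i + 2 ∨ k = i + 3 ∨ k = i + 4 := by omega
          rcases this with rfl | rfl | rfl | rfl | rfl <;> simp at n1 n2 n3 ⊢
        · rcases hu with hu | hu
          · obtain ⟨l, l1, l2, l3, -⟩ := hnb2 (i + 2) (by omega) (by omega) u hxu hu
            exact absurd ⟨l, l1, by omega, l3⟩ hk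
          · exact Or.inl (hS u hxu (fun k k1 k2 e => hk ⟨k, k1, k2, e⟩) hu)
  by_cases hl : G.Adj (p i) (p (i + 2))
  · have h4 : i + 4 ≤ j ∧ G.Adj (p (i + 2)) (p (i + 4)) := by
      by_contra hcon
      have := (h.ear i hl).2.2 {p (i + 3)} ?_
      · simp at this
      · intro u hxu n1 n2 n3 hu
        obtain ⟨l, l1, l2, rfl, l4⟩ := hnb2 (i + 2) (by omega) (by omega) u hxu hu
        have : l = i ∨ l = i + 1 ∨ l = i + 3 ∨ l = i + 4 := by omega
        rcases this with rfl | rfl | rfl | rfl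
        · exact absurd rfl n1
        · exact absurd rfl n2
        · simp
        · exact absurd ⟨l2, hu⟩ hcon
    refine fin ?_ hl h4.2
    by_contra hj
    refine noear (i + 2) (by omega) (by omega) ?_
    have : i + 2 + 2 = i + 4 := by ring
    rw [this]; exact h4.2
  by_cases hr : G.Adj (p (j - 2)) (p j)
  · have hr' : G.Adj (p (j - 2)) (p (j - 2 + 2)) := by
      rw [sub_add_cancel]; exact hr
    have h4 : i ≤ j - 4 ∧ G.Adj (p (j - 4)) (p (j - 2)) := by
      by_contra hcon
      have := (h.ear (j - 2) hr').2.1 {p (j - 3)} ?_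
      · simp at this
      · intro u hxu n1 n2 n3 hu
        obtain ⟨l, l1, l2, rfl, l4⟩ := hnb2 (j - 2) (by omega) (by omega) u hxu hu
        have : l = j - 2 + 2 ∨ l = j - 2 + 1 ∨ l = j - 3 ∨ l = j - 4 := by omega
        rcases this with rfl | rfl | rfl | rfl
        · exact absurd rfl n3
        · exact absurd rfl n2
        · simp
        · exact absurd ⟨l1, hu.symm⟩ hcon
    have hj : j = i + 4 := by
      by_contra hj
      refine noear (j - 4) (by omega) (by omega) ?_
      have : j - 4 + 2 = j - 2 := by ring
      rw [this]; exact h4.2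
    subst hj
    have e1 : i + 4 - 4 = i := by ring
    have e2 : i + 4 - 2 = i + 2 := by ring
    rw [e1, e2] at h4
    rw [e2] at hr
    exact fin rfl h4.2 hr
  exfalso
  refine h.noFlat i j (by omega) hjt hc ?_
  intro m l h1 h2 h3 hml
  by_cases hp : m = i ∧ l = j
  · exact Or.inr hp
  left
  rcases IH m l h1 h2 h3 (by omega) hml with e | e | ⟨e, e'⟩
  · exact e
  · exfalso
    subst e
    by_cases hm : i < m
    · by_cases hm2 : m + 2 < j
      · exact noear m hm hm2 hml
      · have : j = m + 2 := by omega
        subst this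
        rw [add_sub_cancel_right] at hr
        exact hr hml
    · have : m = i := by omega
      subst this
      exact hl hml
  · exact absurd e' (no4 m h1 (by omega) (by omega))

theorem noChord (h : CycSetup G x p t) (i j : ℤ) : ¬ G.Adj (p i) (p j) := by
  intro hij
  have ht := h.ht
  obtain ⟨l, l1, l2, l3⟩ := h.surj (p j) (h.adj j) i
  rw [← l3] at hij
  have hl : i ≠ l := by rintro rfl; exact hij.ne rfl
  have h1 := h.chord_main (l - i).toNat i l (by omega) (by omega) l2 hij
  have h2 := h.chord_main (i + t - l).toNat l (i + t) (by omega) (by omega) (by omega)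
    (by rw [h.per]; exact hij.symm)
  omega

theorem contra (h : CycSetup G x p t) : False := by
  have ht := h.ht
  obtain ⟨R, C, mR, mC, hd, hK⟩ := h.key 0
  have hC : C = ∅ := by
    rw [Finset.eq_empty_iff_forall_notMem]
    intro u hu
    obtain ⟨h1, h2⟩ := (mC _).1 hu
    obtain ⟨l, -, -, rfl⟩ := h.surj u h1 0
    exact h.noChord _ _ h2
  have := hK R (Finset.Subset.refl _) ∅ (by simp) {p 1} (by
    intro w hwR u hwu hxu huy hyu
    obtain ⟨h1, h2, h3⟩ := (mR w).1 hwR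
    obtain ⟨l, l1, l2, rfl⟩ := h.surj u hxu 0
    rw [Finset.mem_singleton]
    by_cases hl : l < 2
    · have : l = 0 ∨ l = 1 := by omega
      rcases this with rfl | rfl
      · exact absurd rfl huy
      · rfl
    · exfalso
      exact h.noHub l.toNat 0 l (by omega) (by omega) (by omega) w h3 h2 h1 hwu.symm
        (fun m _ _ l' hml => absurd hml (h.noChord _ _))) (by simp)
  rw [hC] at this hd
  simp only [Finset.card_empty, Finset.card_singleton] at this hd
  omega

end CycSetup

end Combi

/-- Claim 1: in a simple connected positively curved planar graph with minimum degree
at least 3, drawn in the plane, if `x` is a max-degree vertex with `deg x ≥ 18` and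
`v` enumerates the neighbors of `x` in clockwise order, then every `ℓ`-cap with
`ℓ ≥ 3` contains a `2`-cap `v i, v (i+2)` with `k ≤ i ≤ k+ℓ-2`, for which the common
neighborhood of `v (i+1)` and `x` is exactly `{v i, v (i+2)}`. -/
theorem cap_contains_two_cap (G : SimpleGraph V) [G.LocallyFinite]
    (hconn : G.Connected) (hplanar : IsPlanar G)
    (hmin : ∀ u : V, 3 ≤ G.degree u) (hpos : PositivelyCurved G)
    (x : V) (hmax : ∀ u : V, G.degree u ≤ G.degree x) (hdx : 18 ≤ G.degree x)
    (t : ℕ) (ht : t = G.degree x) (v : ℕ → V)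
    (hper : ∀ i : ℕ, v (i + t) = v i)
    (hvinj : ∀ i < t, ∀ j < t, v i = v j → i = j)
    (hvmem : ∀ i : ℕ, G.Adj x (v i))
    (hvsurj : ∀ u : V, G.Adj x u → ∃ i < t, v i = u)
    (k ℓ : ℕ) (hℓ : 3 ≤ ℓ) (hcap : IsCap G x v k ℓ) :
    ∃ i : ℕ, k ≤ i ∧ i + 2 ≤ k + ℓ ∧ IsCap G x v i 2 ∧
      G.neighborSet (v (i + 1)) ∩ G.neighborSet x = {v i, v (i + 2)} := by
  exfalso
  classical
  obtain ⟨p, hp⟩ := exists_cyc G hconn hplanar hmin hpos x hdx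
  exact hp.contra
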